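/- Assume N = 3 and that χ_σ corresponds to the character 1⊗1⊗η of (k_F^×)³, i.e. χ_σ(i) = η(third diagonal entry of red(i)), where η is a nontrivial character of k_F^× (so W(χ_σ) = {Id, ω_1}). For a ∈ S_{Id} ∪ S_{ω_1} write f_a = f_{Id,a} if a ∈ S_{Id} and f_a = f_{ω_1,a} if a ∈ S_{ω_1}. Then: (1) f_a|T_{ω_1} = f_{(a_2,a_1)} if a_1 > a_2; there is a constant c ∈ {0,−1} ⊆ \bar{𝔽}_p depending only on σ such that f_a|T_{ω_1} = c·f_a whenever a_1 = a_2; and f_a|T_{ω_1} = −f_a if a_1 < a_2. (2) For every a ∈ S_{Id} ∪ S_{ω_1}, f_a|T_{ω_1·t_{(0,−1)}} = f_{(a_2, a_1−1)}. (3) f|T_{ω_1·t_{(1,0)}} = 0 for every f in the isotypic subspace (ind_{KZ}^G σ)^{IZ, χ_σ} = {f : i·f = χ_σ(i) f for all i ∈ I}. -/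

import Mathlib

open Matrix

noncomputable section

namespace IH

variable (p : ℕ) [Fact p.Prime]

/-- `\bar{𝔽}_p`, an algebraic closure of the residue field. -/
abbrev kb := AlgebraicClosure (ZMod p)

variable (N : ℕ)

/-- `G = GL_N(F)` with `F = ℚ_p`. -/
abbrev GG := GL (Fin N) ℚ_[p]
/-- `GL_N(O_F)` (as an abstract group, mapping onto `K ⊆ G`). -/
abbrev MM := GL (Fin N) ℤ_[p]
/-- `GL_N(k_F)`. -/
abbrev Gk := GL (Fin N) (ZMod p)

/-- The inclusion `GL_N(O_F) → GL_N(F)`. -/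
def iotaM : MM p N →* GG p N := Matrix.GeneralLinearGroup.map (PadicInt.Coe.ringHom)

/-- The reduction map `red : GL_N(O_F) → GL_N(k_F)`. -/
def redM : MM p N →* Gk p N := Matrix.GeneralLinearGroup.map (PadicInt.toZMod)

/-- Elements of `GL_N(O_F)` whose reduction is upper triangular: the Iwahori condition. -/
def Ipre : Set (MM p N) :=
  {m | ∀ i j : Fin N, j < i → ((redM p N m : Matrix (Fin N) (Fin N) (ZMod p)) i j = 0)}

/-- Elements of `GL_N(O_F)` whose reduction is upper triangular unipotent: pro-p Iwahori. -/
def I1pre : Set (MM p N) :=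
  {m | m ∈ Ipre p N ∧ ∀ i : Fin N, ((redM p N m : Matrix (Fin N) (Fin N) (ZMod p)) i i = 1)}

/-- Elements of `GL_N(O_F)` reducing to the identity: `K_1 = ker red`. -/
def K1pre : Set (MM p N) := {m | redM p N m = 1}

/-- `K = GL_N(O_F)` as a subset of `G`. -/
def Kset : Set (GG p N) := Set.range (iotaM p N)
/-- The Iwahori subgroup `I ⊆ G`. -/
def Iset : Set (GG p N) := iotaM p N '' Ipre p N
/-- The pro-p Iwahori subgroup `I_1 ⊆ G`. -/
def I1set : Set (GG p N) := iotaM p N '' I1pre p N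
/-- `K_1 ⊆ G`. -/
def K1set : Set (GG p N) := iotaM p N '' K1pre p N

/-- The uniformizer `ϖ = p` as a unit of `ℚ_p`. -/
def pU : ℚ_[p]ˣ :=
  Units.mk0 (p : ℚ_[p]) (by
    have h := (Fact.out : p.Prime).ne_zero
    exact_mod_cast Nat.cast_ne_zero.mpr h)

/-- Scalar matrices as elements of `G`. -/
def scalarGL (u : ℚ_[p]ˣ) : GG p N :=
  Units.map (algebraMap ℚ_[p] (Matrix (Fin N) (Fin N) ℚ_[p])).toMonoidHom u

/-- The central element `ϖ^n · Id`. -/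
def piSc (n : ℤ) : GG p N := scalarGL p N (pU p ^ n)

/-- Invertible diagonal matrices. -/
def diagGL (d : Fin N → ℚ_[p]ˣ) : GG p N where
  val := Matrix.diagonal fun i => (d i : ℚ_[p])
  inv := Matrix.diagonal fun i => (((d i)⁻¹ : ℚ_[p]ˣ) : ℚ_[p])
  val_inv := by
    rw [Matrix.diagonal_mul_diagonal]
    simp
  inv_val := by
    rw [Matrix.diagonal_mul_diagonal]
    simp

/-- extend `a ∈ ℤ^{N-1}` by `0` in the last coordinate. -/
def expo (a : Fin (N - 1) → ℤ) : Fin N → ℤ :=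
  fun i => if h : (i : ℕ) < N - 1 then a ⟨i, h⟩ else 0

/-- `t_a = diag(ϖ^{a_1}, …, ϖ^{a_{N-1}}, 1)`. -/
def tGL (a : Fin (N - 1) → ℤ) : GG p N :=
  diagGL p N fun i => pU p ^ (expo N a i)

/-- The permutation matrix of `σ` (with `permGL σ · e_j = e_{σ j}`, so that
`permGL` is a group homomorphism). -/
def permGL (σ : Equiv.Perm (Fin N)) : GG p N where
  val := (σ⁻¹).permMatrix ℚ_[p]
  inv := σ.permMatrix ℚ_[p]
  val_inv := by
    show ((σ⁻¹).toPEquiv.toMatrix : Matrix (Fin N) (Fin N) ℚ_[p]) * σ.toPEquiv.toMatrix = 1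
    rw [← PEquiv.toMatrix_trans, ← Equiv.toPEquiv_trans]
    simp only [Equiv.self_trans_symm, Equiv.symm_trans_self, Equiv.Perm.inv_def]
    rw [Equiv.toPEquiv_refl, PEquiv.toMatrix_refl]
  inv_val := by
    show (σ.toPEquiv.toMatrix : Matrix (Fin N) (Fin N) ℚ_[p]) * (σ⁻¹).toPEquiv.toMatrix = 1
    rw [← PEquiv.toMatrix_trans, ← Equiv.toPEquiv_trans]
    simp only [Equiv.self_trans_symm, Equiv.symm_trans_self, Equiv.Perm.inv_def]
    rw [Equiv.toPEquiv_refl, PEquiv.toMatrix_refl]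

/-- `ω t_a`. -/
def wS (σ : Equiv.Perm (Fin N)) (a : Fin (N - 1) → ℤ) : GG p N :=
  permGL p N σ * tGL p N a

/-- The permutation `ω₂` (as a matrix: first row block `(0, I_{N-1})`, last row `(1,0,…,0)`). -/
def w2 : Equiv.Perm (Fin N) := (finRotate N)⁻¹

/-- `γ = ω₂ · diag(ϖ, I_{N-1})`. -/
def gammaGL : GG p N :=
  permGL p N (w2 N) * tGL p N fun i => if (i : ℕ) = 0 then 1 else 0

/-- `S_ω = {a ∈ ℤ^{N-1} : (ω t_a) I (ω t_a)⁻¹ ∩ K ⊆ I}`. -/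
def Sset (σ : Equiv.Perm (Fin N)) : Set (Fin (N - 1) → ℤ) :=
  {a | ∀ g ∈ Iset p N,
    wS p N σ a * g * (wS p N σ a)⁻¹ ∈ Kset p N →
    wS p N σ a * g * (wS p N σ a)⁻¹ ∈ Iset p N}

/-- The unit of `k_F^×` attached to a nonzero element of `k_F` (junk value `1` at `0`). -/
def unitOf (x : ZMod p) : (ZMod p)ˣ :=
  if h : x = 0 then 1 else Units.mk0 x h

/-- The diagonal of the reduction of `m`, as an `N`-tuple of units of `k_F`. -/
def diagOf (m : MM p N) : Fin N → (ZMod p)ˣ :=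
  fun i => unitOf p ((redM p N m : Matrix (Fin N) (Fin N) (ZMod p)) i i)

/-- The transformation rule for functions in `H_{IZ}(χ)`, where the character `χ` of `I`
is given by the character `ξ` of the torus `(k_F^×)^N` through the diagonal of the
reduction, extended to `IZ` by `χ(ϖ) = 1`. -/
def HTransf (ξ : (Fin N → (ZMod p)ˣ) →* (kb p)ˣ) (φ : GG p N → kb p) : Prop :=
  ∀ (n₁ n₂ : ℤ) (m₁ m₂ : MM p N), m₁ ∈ Ipre p N → m₂ ∈ Ipre p N → ∀ g : GG p N,
    φ (piSc p N n₁ * iotaM p N m₁ * g * (piSc p N n₂ * iotaM p N m₂)) =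
      (ξ (diagOf p N m₁) : kb p) * (ξ (diagOf p N m₂) : kb p) * φ g

/-- `φ` is supported on the double coset `IZ x I`. -/
def SuppDouble (φ : GG p N → kb p) (x : GG p N) : Prop :=
  ∀ g : GG p N, φ g ≠ 0 → ∃ (n : ℤ) (m₁ m₂ : MM p N), m₁ ∈ Ipre p N ∧ m₂ ∈ Ipre p N ∧
    g = piSc p N n * iotaM p N m₁ * x * iotaM p N m₂

/-- Membership in `H_{IZ}(χ)`: the transformation rule together with support in
finitely many double cosets `IZ g I`. -/
def HMem (ξ : (Fin N → (ZMod p)ˣ) →* (kb p)ˣ) (φ : GG p N → kb p) : Prop :=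
  HTransf p N ξ φ ∧
  ∃ S : Finset (GG p N), ∀ g : GG p N, φ g ≠ 0 →
    ∃ s ∈ S, ∃ (n : ℤ) (m₁ m₂ : MM p N), m₁ ∈ Ipre p N ∧ m₂ ∈ Ipre p N ∧
      g = piSc p N n * iotaM p N m₁ * s * iotaM p N m₂

section Rep

variable {V : Type} [AddCommGroup V] [Module (kb p) V]

/-- `σ` (here `ρ`) is irreducible. -/
def IsIrred (ρ : Representation (kb p) (Gk p N) V) : Prop :=
  (∃ v : V, v ≠ 0) ∧
  ∀ W : Submodule (kb p) V, (∀ g v, v ∈ W → ρ g v ∈ W) → W = ⊥ ∨ W = ⊤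

/-- Membership in the compact induction `ind_{KZ}^G σ`: left `KZ`-equivariance
(where `ϖ` acts trivially), support in finitely many cosets `KZ g`, and smoothness. -/
def IndMem (ρ : Representation (kb p) (Gk p N) V) (f : GG p N → V) : Prop :=
  (∀ (n : ℤ) (m : MM p N) (g : GG p N),
      f (piSc p N n * iotaM p N m * g) = ρ (redM p N m) (f g)) ∧
  (∃ S : Finset (GG p N), ∀ g : GG p N, f g ≠ 0 →
      ∃ s ∈ S, ∃ (n : ℤ) (m : MM p N), g = piSc p N n * iotaM p N m * s) ∧
  (∃ U : Subgroup (GG p N), IsOpen (U : Set (GG p N)) ∧ ∀ u ∈ U, ∀ g, f (g * u) = f g)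

/-- `f` is invariant under right translation by `I_1`. -/
def IsI1Inv (f : GG p N → V) : Prop :=
  ∀ u ∈ I1set p N, ∀ g, f (g * u) = f g

/-- The defining property of the standard function `f_{ω,a}`: an `I_1`-invariant member of
`ind_{KZ}^G σ` supported on `KZ t_a I_1` with value `v₀` at `ω t_a`. -/
def IsStd (ρ : Representation (kb p) (Gk p N) V) (v₀ : V)
    (σp : Equiv.Perm (Fin N)) (a : Fin (N - 1) → ℤ) (f : GG p N → V) : Prop :=
  IndMem p N ρ f ∧ IsI1Inv p N f ∧
  (∀ g : GG p N, f g ≠ 0 → ∃ (n : ℤ) (m : MM p N) (u : GG p N), u ∈ I1set p N ∧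
      g = piSc p N n * iotaM p N m * tGL p N a * u) ∧
  f (wS p N σp a) = v₀

/-- `R` is a set of representatives for `I_1/(I_1 ∩ g⁻¹ I_1 g)`. -/
def IsRepSet (g : GG p N) (R : Finset (GG p N)) : Prop :=
  (↑R ⊆ I1set p N) ∧
  ∀ x ∈ I1set p N, ∃! r : GG p N, r ∈ R ∧
    (r⁻¹ * x ∈ I1set p N ∧ g * (r⁻¹ * x) * g⁻¹ ∈ I1set p N)

/-- The Hecke operator: `f|T_g = ∑_{r} (r g⁻¹)·f`, where `(h·f)(x) = f(xh)`. -/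
def hk (g : GG p N) (R : Finset (GG p N)) (f : GG p N → V) : GG p N → V :=
  fun x => ∑ r ∈ R, f (x * r * g⁻¹)

end Rep


/-- The defining property of `f_a` for `a ∈ S_{Id} ∪ S_{ω₁}` (semi-regular case). -/
def IsFsr (p : ℕ) [Fact p.Prime] {V : Type} [AddCommGroup V] [Module (kb p) V]
    (ρ : Representation (kb p) (Gk p 3) V) (v₀ : V) (a : Fin 2 → ℤ)
    (f : GG p 3 → V) : Prop :=
  (a ∈ Sset p 3 1 ∧ IsStd p 3 ρ v₀ 1 a f) ∨
  (a ∈ Sset p 3 (Equiv.swap (0 : Fin 3) 1) ∧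
    IsStd p 3 ρ v₀ (Equiv.swap (0 : Fin 3) 1) a f)

section Elementary

variable {R : Type*} [CommRing R]

/-- The elementary matrix `1 + t E_{ij}` as an element of `GL_3`. -/
def elemGL (i j : Fin 3) (h : i ≠ j) (t : R) : GL (Fin 3) R where
  val := transvection i j t
  inv := transvection i j (-t)
  val_inv := by rw [transvection_mul_transvection_same _ _ h]; simp
  inv_val := by rw [transvection_mul_transvection_same _ _ h]; simp

/-- The permutation matrix of `σ` in `GL_3(R)`, sending `e_j` to `e_{σ j}`. -/
def weylGL (R : Type*) [CommRing R] (σ : Equiv.Perm (Fin 3)) : GL (Fin 3) R where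
  val := (σ⁻¹).permMatrix R
  inv := σ.permMatrix R
  val_inv := by rw [← Matrix.permMatrix_mul]; simp
  inv_val := by rw [← Matrix.permMatrix_mul]; simp

/-- The diagonal matrix with unit entries `d`. -/
def torusGL (d : Fin 3 → Rˣ) : GL (Fin 3) R where
  val := Matrix.diagonal fun i => (d i : R)
  inv := Matrix.diagonal fun i => (((d i)⁻¹ : Rˣ) : R)
  val_inv := by rw [Matrix.diagonal_mul_diagonal]; simp
  inv_val := by rw [Matrix.diagonal_mul_diagonal]; simp

/-- The image of `diag(u, -u⁻¹)` in the rank one subgroup attached to `i, j`. -/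
def rootTorus (i j : Fin 3) (u : Rˣ) : Fin 3 → Rˣ :=
  fun k => if k = i then u else if k = j then -u⁻¹ else 1

theorem elemGL_apply (i j : Fin 3) (h : i ≠ j) (t : R) (a b : Fin 3) :
    (elemGL i j h t : Matrix (Fin 3) (Fin 3) R) a b =
      (if a = b then 1 else 0) + if i = a ∧ j = b then t else 0 := by
  simp [elemGL, transvection, Matrix.one_apply, Matrix.single_apply]

theorem weylGL_apply (σ : Equiv.Perm (Fin 3)) (a b : Fin 3) :
    (weylGL R σ : Matrix (Fin 3) (Fin 3) R) a b = if a = σ b then 1 else 0 := by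
  simp [weylGL, PEquiv.toMatrix_apply, Equiv.symm_apply_eq]

theorem torusGL_apply (d : Fin 3 → Rˣ) (a b : Fin 3) :
    (torusGL d : Matrix (Fin 3) (Fin 3) R) a b = if a = b then (d a : R) else 0 := by
  simp [torusGL, Matrix.diagonal_apply]

theorem elemGL_add (i j : Fin 3) (h : i ≠ j) (s t : R) :
    elemGL i j h (s + t) = elemGL i j h s * elemGL i j h t := by
  apply Units.ext
  exact (transvection_mul_transvection_same _ _ h _ _).symm

theorem elemGL_zero (i j : Fin 3) (h : i ≠ j) : elemGL i j h (0 : R) = 1 := by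
  apply Units.ext
  simp [elemGL]

theorem elemGL_inv (i j : Fin 3) (h : i ≠ j) (t : R) :
    (elemGL i j h t)⁻¹ = elemGL i j h (-t) := by
  rw [inv_eq_iff_mul_eq_one, ← elemGL_add, add_neg_cancel, elemGL_zero]

theorem elemGL_natCast (i j : Fin 3) (h : i ≠ j) (n : ℕ) :
    elemGL i j h (n : R) = elemGL i j h 1 ^ n := by
  induction n with
  | zero => simp [elemGL_zero]
  | succ n ih => rw [Nat.cast_succ, elemGL_add, ih, pow_succ]

theorem weylGL_mul (σ τ : Equiv.Perm (Fin 3)) :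
    weylGL R (σ * τ) = weylGL R σ * weylGL R τ := by
  apply Units.ext
  show ((σ * τ)⁻¹).permMatrix R = (σ⁻¹).permMatrix R * (τ⁻¹).permMatrix R
  rw [← Matrix.permMatrix_mul, _root_.mul_inv_rev]

theorem weylGL_one : weylGL R 1 = 1 := by
  apply Units.ext
  simp [weylGL]

theorem weylGL_swap_mul_self (i j : Fin 3) :
    weylGL R (Equiv.swap i j) * weylGL R (Equiv.swap i j) = 1 := by
  rw [← weylGL_mul, Equiv.swap_mul_self, weylGL_one]

theorem weylGL_mul_apply (σ : Equiv.Perm (Fin 3)) (g : GL (Fin 3) R) (a b : Fin 3) :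
    ((weylGL R σ * g : GL (Fin 3) R) : Matrix (Fin 3) (Fin 3) R) a b = g (σ⁻¹ a) b := by
  rw [Matrix.GeneralLinearGroup.coe_mul, Matrix.mul_apply,
    Finset.sum_eq_single (σ⁻¹ a)]
  · simp [weylGL_apply]
  · intro c _ hc
    rw [weylGL_apply, if_neg, zero_mul]
    rintro rfl
    simp at hc
  · simp

theorem mul_weylGL_apply (σ : Equiv.Perm (Fin 3)) (g : GL (Fin 3) R) (a b : Fin 3) :
    ((g * weylGL R σ : GL (Fin 3) R) : Matrix (Fin 3) (Fin 3) R) a b = g a (σ b) := by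
  rw [Matrix.GeneralLinearGroup.coe_mul, Matrix.mul_apply,
    Finset.sum_eq_single (σ b)]
  · simp [weylGL_apply]
  · intro c _ hc
    rw [weylGL_apply, if_neg hc, mul_zero]
  · simp

theorem torusGL_mul_apply (d : Fin 3 → Rˣ) (g : GL (Fin 3) R) (a b : Fin 3) :
    ((torusGL d * g : GL (Fin 3) R) : Matrix (Fin 3) (Fin 3) R) a b = d a * g a b := by
  rw [Matrix.GeneralLinearGroup.coe_mul]
  exact Matrix.diagonal_mul _ _ _ _

theorem mul_torusGL_apply (d : Fin 3 → Rˣ) (g : GL (Fin 3) R) (a b : Fin 3) :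
    ((g * torusGL d : GL (Fin 3) R) : Matrix (Fin 3) (Fin 3) R) a b = g a b * d b := by
  rw [Matrix.GeneralLinearGroup.coe_mul]
  exact Matrix.mul_diagonal _ _ _ _

theorem torusGL_mul (d e : Fin 3 → Rˣ) : torusGL (d * e) = torusGL d * torusGL e := by
  ext a b
  rw [torusGL_mul_apply, torusGL_apply, torusGL_apply]
  split_ifs <;> simp

theorem torusGL_one : torusGL (1 : Fin 3 → Rˣ) = 1 := by
  apply Units.ext
  simp [torusGL]

theorem torusGL_inv (d : Fin 3 → Rˣ) : (torusGL d)⁻¹ = torusGL d⁻¹ := by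
  rw [inv_eq_iff_mul_eq_one, ← torusGL_mul, mul_inv_cancel, torusGL_one]

theorem weylGL_mul_elemGL (σ : Equiv.Perm (Fin 3)) (i j : Fin 3) (h : i ≠ j) (t : R) :
    weylGL R σ * elemGL i j h t =
      elemGL (σ i) (σ j) (σ.injective.ne h) t * weylGL R σ := by
  ext a b
  rw [weylGL_mul_apply, mul_weylGL_apply, elemGL_apply, elemGL_apply]
  simp only [Equiv.Perm.inv_def, Equiv.symm_apply_eq, Equiv.eq_symm_apply, EmbeddingLike.apply_eq_iff_eq]

theorem weylGL_mul_torusGL (σ : Equiv.Perm (Fin 3)) (d : Fin 3 → Rˣ) :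
    weylGL R σ * torusGL d = torusGL (fun k => d (σ⁻¹ k)) * weylGL R σ := by
  ext a b
  rw [weylGL_mul_apply, mul_weylGL_apply, torusGL_apply, torusGL_apply]
  simp only [Equiv.Perm.inv_def, Equiv.symm_apply_eq]

theorem torusGL_mul_weylGL (σ : Equiv.Perm (Fin 3)) (d : Fin 3 → Rˣ) :
    torusGL d * weylGL R σ = weylGL R σ * torusGL (fun k => d (σ k)) := by
  rw [weylGL_mul_torusGL]
  simp

theorem torusGL_mul_elemGL (d : Fin 3 → Rˣ) (i j : Fin 3) (h : i ≠ j) (t : R) :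
    torusGL d * elemGL i j h t = elemGL i j h (d i * t * ↑(d j)⁻¹) * torusGL d := by
  ext a b
  rw [torusGL_mul_apply, mul_torusGL_apply, elemGL_apply, elemGL_apply]
  by_cases hab : a = b
  · subst hab
    have : ¬ (i = a ∧ j = a) := fun h' => h (h'.1.trans h'.2.symm)
    simp [this]
  · by_cases hij : i = a ∧ j = b
    · obtain ⟨rfl, rfl⟩ := hij
      simp [hab, mul_assoc]
    · simp [hab, hij]

theorem elemGL_mul_weylGL_swap (i j : Fin 3) (h : i ≠ j) (u : Rˣ) :
    elemGL i j h (u : R) * weylGL R (Equiv.swap i j) =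
      elemGL j i h.symm (↑u⁻¹ : R) * torusGL (rootTorus i j u) * elemGL i j h (↑u⁻¹ : R) := by
  rw [mul_assoc, torusGL_mul_elemGL, ← mul_assoc]
  ext a b
  rw [mul_weylGL_apply, mul_torusGL_apply, Matrix.GeneralLinearGroup.coe_mul, Matrix.mul_apply,
    Fin.sum_univ_three]
  simp only [elemGL_apply, rootTorus]
  fin_cases i <;> fin_cases j <;> first | exact absurd rfl h | skip
  all_goals fin_cases a <;> fin_cases b <;> simp [Equiv.swap_apply_def]

/-- The same relation read on the opposite root subgroup. -/
theorem elemGL_eq_mul_weylGL_swap (i j : Fin 3) (h : i ≠ j) (u : Rˣ) :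
    elemGL i j h (u : R) =
      elemGL j i h.symm (↑u⁻¹ : R) * torusGL (rootTorus i j u) * weylGL R (Equiv.swap i j) *
        elemGL j i h.symm (↑u⁻¹ : R) := by
  have h1 := weylGL_mul_elemGL (Equiv.swap i j) j i h.symm (↑u⁻¹ : R)
  simp only [Equiv.swap_apply_left, Equiv.swap_apply_right] at h1
  rw [mul_assoc _ (weylGL R (Equiv.swap i j)), h1, ← mul_assoc, ← elemGL_mul_weylGL_swap,
    mul_assoc, weylGL_swap_mul_self, mul_one]

theorem elemGL_mul_comm_left (i j l : Fin 3) (h : i ≠ j) (h' : i ≠ l) (s t : R) :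
    elemGL i j h s * elemGL i l h' t = elemGL i l h' t * elemGL i j h s := by
  ext a b
  simp only [Matrix.GeneralLinearGroup.coe_mul, Matrix.mul_apply, Fin.sum_univ_three, elemGL_apply]
  fin_cases i <;> fin_cases j <;> first | exact absurd rfl h | skip
  all_goals fin_cases l <;> first | exact absurd rfl h' | skip
  all_goals fin_cases a <;> fin_cases b <;> simp [add_comm]

theorem elemGL_mul_comm_right (i j l : Fin 3) (h : i ≠ j) (h' : l ≠ j) (s t : R) :
    elemGL i j h s * elemGL l j h' t = elemGL l j h' t * elemGL i j h s := by
  ext a b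
  simp only [Matrix.GeneralLinearGroup.coe_mul, Matrix.mul_apply, Fin.sum_univ_three, elemGL_apply]
  fin_cases i <;> fin_cases j <;> first | exact absurd rfl h | skip
  all_goals fin_cases l <;> first | exact absurd rfl h' | skip
  all_goals fin_cases a <;> fin_cases b <;> simp [add_comm]

theorem elemGL_commutator (i j l : Fin 3) (h : i ≠ j) (h' : j ≠ l) (h'' : i ≠ l) (s t : R) :
    elemGL i j h s * elemGL j l h' t =
      elemGL j l h' t * elemGL i j h s * elemGL i l h'' (s * t) := by
  ext a b
  simp only [Matrix.GeneralLinearGroup.coe_mul, Matrix.mul_apply, Fin.sum_univ_three, elemGL_apply]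
  fin_cases i <;> fin_cases j <;> first | exact absurd rfl h | skip
  all_goals fin_cases l <;> first | exact absurd rfl h' | exact absurd rfl h'' | skip
  all_goals fin_cases a <;> fin_cases b <;> simp

variable {S : Type*} [CommRing S]

theorem map_elemGL (φ : R →+* S) (i j : Fin 3) (h : i ≠ j) (t : R) :
    Matrix.GeneralLinearGroup.map φ (elemGL i j h t) = elemGL i j h (φ t) := by
  ext a b
  rw [Matrix.GeneralLinearGroup.map_apply, elemGL_apply, elemGL_apply]
  split_ifs <;> simp

theorem map_weylGL (φ : R →+* S) (σ : Equiv.Perm (Fin 3)) :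
    Matrix.GeneralLinearGroup.map φ (weylGL R σ) = weylGL S σ := by
  ext a b
  rw [Matrix.GeneralLinearGroup.map_apply, weylGL_apply, weylGL_apply]
  split_ifs <;> simp

theorem map_torusGL (φ : R →+* S) (d : Fin 3 → Rˣ) :
    Matrix.GeneralLinearGroup.map φ (torusGL d) =
      torusGL fun k => Units.map (φ : R →* S) (d k) := by
  ext a b
  rw [Matrix.GeneralLinearGroup.map_apply, torusGL_apply, torusGL_apply]
  split_ifs <;> simp

end Elementary

section FiniteGroup

open Module

variable {p}

theorem sum_eq_zero_add_sum_units {M : Type*} [AddCommMonoid M] (g : ZMod p → M) :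
    ∑ t, g t = g 0 + ∑ u : (ZMod p)ˣ, g u := by
  rw [Fintype.sum_eq_add_sum_subtype_ne g 0]
  congr 1
  exact (Fintype.sum_equiv unitsEquivNeZero (fun u : (ZMod p)ˣ => g u) _ fun _ => rfl).symm

/-- The unipotent lower triangular matrices. -/
def IsLowerUni {R : Type*} [CommRing R] (g : GL (Fin 3) R) : Prop :=
  g 0 0 = 1 ∧ g 1 1 = 1 ∧ g 2 2 = 1 ∧ g 0 1 = 0 ∧ g 0 2 = 0 ∧ g 1 2 = 0

section LowerUni

variable {R : Type*} [CommRing R]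

theorem IsLowerUni.one : IsLowerUni (1 : GL (Fin 3) R) := by
  simp [IsLowerUni]

theorem IsLowerUni.mul {g h : GL (Fin 3) R} (hg : IsLowerUni g) (hh : IsLowerUni h) :
    IsLowerUni (g * h) := by
  obtain ⟨h1, h2, h3, h4, h5, h6⟩ := hg
  obtain ⟨k1, k2, k3, k4, k5, k6⟩ := hh
  simp [IsLowerUni, Matrix.mul_apply, Fin.sum_univ_three, *]

theorem isLowerUni_elemGL {i j : Fin 3} (h : j < i) (t : R) :
    IsLowerUni (elemGL i j h.ne' t) := by
  fin_cases i <;> fin_cases j <;> first | exact absurd h (by decide) | skip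
  all_goals simp [IsLowerUni, elemGL_apply]

theorem IsLowerUni.torus {g : GL (Fin 3) R} (hg : IsLowerUni g) (d : Fin 3 → Rˣ) :
    IsLowerUni (torusGL d * g * (torusGL d)⁻¹) := by
  obtain ⟨h1, h2, h3, h4, h5, h6⟩ := hg
  simp only [IsLowerUni, torusGL_inv, mul_torusGL_apply, torusGL_mul_apply, h1, h2, h3, h4, h5, h6]
  simp

theorem IsLowerUni.eq_mul {g : GL (Fin 3) R} (hg : IsLowerUni g) :
    g = elemGL 2 0 (by decide) (g 2 0) * elemGL 1 0 (by decide) (g 1 0) *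
      elemGL 2 1 (by decide) (g 2 1) := by
  obtain ⟨h1, h2, h3, h4, h5, h6⟩ := hg
  ext a b
  fin_cases a <;> fin_cases b <;>
    simp [Matrix.mul_apply, Fin.sum_univ_three, elemGL_apply, *]

/-- Conjugation by a simple reflection preserves the unipotent radical of the opposite
parabolic subgroup. -/
theorem IsLowerUni.swap {g : GL (Fin 3) R} (hg : IsLowerUni g) {i j : Fin 3}
    (hij : j.val = i.val + 1) (h0 : g j i = 0) :
    IsLowerUni (weylGL R (Equiv.swap i j) * g * weylGL R (Equiv.swap i j)) := by
  obtain ⟨h1, h2, h3, h4, h5, h6⟩ := hg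
  fin_cases i <;> fin_cases j <;> simp at hij h0 <;>
    simp only [IsLowerUni, mul_weylGL_apply, weylGL_mul_apply, Equiv.swap_inv] <;>
    simp [Equiv.swap_apply_def, *]

end LowerUni

variable {V : Type} [AddCommGroup V] [Module (kb p) V]

theorem exists_fixed_of_pow_eq_one (N : Submodule (kb p) V) (hN : N ≠ ⊥) (A : End (kb p) V)
    (hA : A ^ p = 1) (hAN : ∀ m ∈ N, A m ∈ N) : ∃ m ∈ N, m ≠ 0 ∧ A m = m := by
  obtain ⟨m, hm, hm0⟩ := Submodule.exists_mem_ne_zero_of_ne_bot hN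
  have : Nontrivial V := ⟨m, 0, hm0⟩
  have : CharP (End (kb p) V) p :=
    charP_of_injective_algebraMap (FaithfulSMul.algebraMap_injective (kb p) (End (kb p) V)) p
  have hnil : (A - 1) ^ p = 0 := by
    rw [sub_pow_char_of_commute _ (Commute.one_right A), hA, one_pow, sub_self]
  classical
  have hex : ∃ n, ((A - 1) ^ n : End (kb p) V) m = 0 := ⟨p, by rw [hnil]; rfl⟩
  have hmem : ∀ n, ((A - 1) ^ n : End (kb p) V) m ∈ N := by
    intro n
    induction n with
    | zero => simpa using hm
    | succ n ih =>
      rw [pow_succ', End.mul_apply, LinearMap.sub_apply]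
      exact N.sub_mem (hAN _ ih) ih
  have hpos : Nat.find hex ≠ 0 := by
    intro h0
    have := Nat.find_spec hex
    rw [h0] at this
    exact hm0 (by simpa using this)
  obtain ⟨n, hn⟩ := Nat.exists_eq_succ_of_ne_zero hpos
  refine ⟨((A - 1) ^ n : End (kb p) V) m, hmem n, Nat.find_min hex (by omega), ?_⟩
  have := Nat.find_spec hex
  rw [hn, Nat.succ_eq_add_one, pow_succ', End.mul_apply, LinearMap.sub_apply] at this
  exact sub_eq_zero.mp this

variable (ρ : Representation (kb p) (Gk p 3) V)

theorem rho_mul (g h : Gk p 3) (v : V) : ρ (g * h) v = ρ g (ρ h v) := by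
  rw [map_mul, End.mul_apply]

theorem rho_elemGL_pow (i j : Fin 3) (h : i ≠ j) : ρ (elemGL i j h 1) ^ p = 1 := by
  rw [← map_pow, ← elemGL_natCast, CharP.cast_eq_zero, elemGL_zero, map_one]

theorem fixed_elemGL (i j : Fin 3) (h : i ≠ j) {v : V} (hv : ρ (elemGL i j h 1) v = v)
    (t : ZMod p) : ρ (elemGL i j h t) v = v := by
  rw [← ZMod.natCast_zmod_val t, elemGL_natCast]
  induction t.val with
  | zero => simp
  | succ n ih => rw [pow_succ, rho_mul, hv, ih]

theorem exists_lower_fixed [Nontrivial V] :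
    ∃ v : V, v ≠ 0 ∧ ∀ (i j : Fin 3) (h : j < i) (t : ZMod p), ρ (elemGL i j h.ne' t) v = v := by
  set A := ρ (elemGL 2 0 (by decide) 1) with hA
  set B := ρ (elemGL 1 0 (by decide) 1) with hB
  set C := ρ (elemGL 2 1 (by decide) 1) with hC
  have hAB : ∀ v, A (B v) = B (A v) := fun v => by
    rw [hA, hB, ← rho_mul, ← rho_mul, elemGL_mul_comm_right]
  have hAC : ∀ v, A (C v) = C (A v) := fun v => by
    rw [hA, hC, ← rho_mul, ← rho_mul, elemGL_mul_comm_left]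
  have hCB : ∀ v, C (B v) = B (C (A v)) := fun v => by
    rw [hA, hB, hC, ← rho_mul, ← rho_mul, ← rho_mul,
      elemGL_commutator 2 1 0 (by decide) (by decide) (by decide), mul_one, mul_assoc]
  obtain ⟨a, -, ha0, ha⟩ := exists_fixed_of_pow_eq_one (⊤ : Submodule (kb p) V) top_ne_bot A
    (rho_elemGL_pow ρ 2 0 _) (fun _ _ => trivial)
  have memA : ∀ m, m ∈ LinearMap.ker (A - 1) ↔ A m = m := fun m => by
    rw [LinearMap.mem_ker, LinearMap.sub_apply, sub_eq_zero, End.one_apply]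
  have memB : ∀ m, m ∈ LinearMap.ker (B - 1) ↔ B m = m := fun m => by
    rw [LinearMap.mem_ker, LinearMap.sub_apply, sub_eq_zero, End.one_apply]
  obtain ⟨b, hbA, hb0, hb⟩ := exists_fixed_of_pow_eq_one (LinearMap.ker (A - 1))
    (fun h => ha0 (by
      have : a ∈ LinearMap.ker (A - 1) := (memA a).2 ha
      rw [h] at this; exact this)) B (rho_elemGL_pow ρ 1 0 _)
    (fun m hm => by rw [memA] at hm ⊢; rw [hAB, hm])
  obtain ⟨c, hcAB, hc0, hc⟩ := exists_fixed_of_pow_eq_one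
    (LinearMap.ker (A - 1) ⊓ LinearMap.ker (B - 1))
    (fun h => hb0 (by
      have : b ∈ LinearMap.ker (A - 1) ⊓ LinearMap.ker (B - 1) := ⟨hbA, (memB b).2 hb⟩
      rw [h] at this; exact this)) C (rho_elemGL_pow ρ 2 1 _)
    (fun m hm => by
      obtain ⟨h1, h2⟩ := hm
      have h1' := (memA m).1 h1
      have h2' := (memB m).1 h2
      refine ⟨(memA _).2 ?_, (memB _).2 ?_⟩
      · rw [hAC, h1']
      · have := hCB m
        rw [h1', h2'] at this
        exact this.symm)
  have hcA := (memA c).1 hcAB.1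
  have hcB := (memB c).1 hcAB.2
  refine ⟨c, hc0, fun i j h t => ?_⟩
  fin_cases i <;> fin_cases j <;> first | exact absurd h (by decide) | skip
  · exact fixed_elemGL ρ 1 0 _ hcB t
  · exact fixed_elemGL ρ 2 0 _ hcA t
  · exact fixed_elemGL ρ 2 1 _ hc t

/-- A linear functional invariant under the lower triangular unipotent group. -/
def IsLowerInv (ℓ : Dual (kb p) V) : Prop :=
  ∀ (i j : Fin 3) (h : j < i) (t : ZMod p) (v : V), ℓ (ρ (elemGL i j h.ne' t) v) = ℓ v

theorem exists_isLowerInv [Nontrivial V] : ∃ ℓ : Dual (kb p) V, ℓ ≠ 0 ∧ IsLowerInv ρ ℓ := by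
  obtain ⟨ℓ, h0, hℓ⟩ := exists_lower_fixed ρ.dual
  refine ⟨ℓ, h0, fun i j h t v => ?_⟩
  have := LinearMap.congr_fun (hℓ i j h (-t)) v
  rw [Representation.dual_apply, elemGL_inv, neg_neg] at this
  exact this

variable {ρ}

theorem IsLowerInv.apply_of_isLowerUni {ℓ : Dual (kb p) V} (hℓ : IsLowerInv ρ ℓ) {g : Gk p 3}
    (hg : IsLowerUni g) (v : V) : ℓ (ρ g v) = ℓ v := by
  rw [hg.eq_mul, rho_mul, rho_mul, hℓ 2 0 (by decide), hℓ 1 0 (by decide), hℓ 2 1 (by decide)]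

end FiniteGroup

section FiniteHecke

open Module

variable {p}
variable {V : Type} [AddCommGroup V] [Module (kb p) V]
variable (ρ : Representation (kb p) (Gk p 3) V) (η : (ZMod p)ˣ →* (kb p)ˣ)

/-- The vectors fixed by the upper triangular unipotent group on which the torus acts through `η`
of the `l`-th coordinate. -/
def eigU (l : Fin 3) : Submodule (kb p) V where
  carrier := {v | (∀ (i j : Fin 3) (h : i < j) (t : ZMod p), ρ (elemGL i j h.ne t) v = v) ∧
    ∀ d, ρ (torusGL d) v = (η (d l) : kb p) • v}
  add_mem' := fun ⟨h1, h2⟩ ⟨k1, k2⟩ =>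
    ⟨fun i j h t => by rw [map_add, h1 i j h t, k1 i j h t], fun d => by rw [map_add, h2, k2, smul_add]⟩
  zero_mem' := ⟨fun i j h t => map_zero _, fun d => by rw [map_zero, smul_zero]⟩
  smul_mem' := fun c v ⟨h1, h2⟩ =>
    ⟨fun i j h t => by rw [map_smul, h1 i j h t], fun d => by rw [map_smul, h2, smul_comm]⟩

/-- The finite Hecke operator attached to the transposition of `i` and `j`. -/
def heckeT (i j : Fin 3) (h : i ≠ j) : End (kb p) V :=
  ∑ t, ρ (elemGL i j h t * weylGL (ZMod p) (Equiv.swap i j))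

variable {ρ η}

theorem heckeT_apply (i j : Fin 3) (h : i ≠ j) (v : V) :
    heckeT ρ i j h v =
      ∑ t, ρ (elemGL i j h t) (ρ (weylGL (ZMod p) (Equiv.swap i j)) v) := by
  simp [heckeT, LinearMap.sum_apply, map_mul]

theorem lt_of_val_eq_succ {i j : Fin 3} (hij : j.val = i.val + 1) : i < j := by
  rw [Fin.lt_def]; omega

theorem rho_weyl_swap_swap (i j : Fin 3) (v : V) :
    ρ (weylGL (ZMod p) (Equiv.swap i j)) (ρ (weylGL (ZMod p) (Equiv.swap i j)) v) = v := by
  rw [← rho_mul, weylGL_swap_mul_self, map_one, End.one_apply]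

theorem rho_elemGL_weyl {l : Fin 3} {v : V} (hv : v ∈ eigU ρ η l) {i j : Fin 3} (hij : i < j)
    (u : (ZMod p)ˣ) :
    ρ (elemGL i j hij.ne u) (ρ (weylGL (ZMod p) (Equiv.swap i j)) v) =
      (η (rootTorus i j u l) : kb p) • ρ (elemGL j i hij.ne' (↑u⁻¹ : ZMod p)) v := by
  rw [← rho_mul, elemGL_mul_weylGL_swap, rho_mul, hv.1 i j hij, rho_mul, hv.2, map_smul]

theorem rho_weyl_elemGL {l : Fin 3} {v : V} (hv : v ∈ eigU ρ η l) {i j : Fin 3} (hij : i < j)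
    (u : (ZMod p)ˣ) :
    ρ (weylGL (ZMod p) (Equiv.swap i j)) (ρ (elemGL j i hij.ne' u) v) =
      (η (rootTorus i j u l) : kb p) • ρ (elemGL j i hij.ne' (↑u⁻¹ : ZMod p)) v := by
  rw [← rho_elemGL_weyl hv hij, ← rho_mul, ← rho_mul, weylGL_mul_elemGL]
  simp only [Equiv.swap_apply_left, Equiv.swap_apply_right]

theorem heckeT_eq {l : Fin 3} {v : V} (hv : v ∈ eigU ρ η l) {i j : Fin 3} (hij : i < j) :
    heckeT ρ i j hij.ne v = ρ (weylGL (ZMod p) (Equiv.swap i j)) v +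
      ∑ u : (ZMod p)ˣ, (η (rootTorus i j u l) : kb p) •
        ρ (elemGL j i hij.ne' (↑u⁻¹ : ZMod p)) v := by
  rw [heckeT_apply, sum_eq_zero_add_sum_units, elemGL_zero, map_one, End.one_apply]
  simp only [rho_elemGL_weyl hv hij]

theorem heckeT_mem {l : Fin 3} {v : V} (hv : v ∈ eigU ρ η l) {i j : Fin 3}
    (hij : j.val = i.val + 1) :
    heckeT ρ i j (lt_of_val_eq_succ hij).ne v ∈ eigU ρ η (Equiv.swap i j l) := by
  have hlt := lt_of_val_eq_succ hij
  constructor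
  · intro a b h t
    rw [heckeT_apply, map_sum]
    have key : (a = i ∧ b = j) ∨ ∀ s : ZMod p,
        ρ (elemGL a b h.ne t) (ρ (elemGL i j hlt.ne s)
          (ρ (weylGL (ZMod p) (Equiv.swap i j)) v)) =
        ρ (elemGL i j hlt.ne s) (ρ (weylGL (ZMod p) (Equiv.swap i j)) v) := by
      fin_cases i <;> fin_cases j <;> first | exact absurd hij (by decide) | skip
      all_goals fin_cases a <;> fin_cases b <;> first | exact absurd h (by decide) | skip
      · exact Or.inl ⟨rfl, rfl⟩
      · right
        intro s
        have h1 : weylGL (ZMod p) (Equiv.swap 0 1) * elemGL 1 2 (by decide) t =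
          elemGL 0 2 (by decide) t * weylGL (ZMod p) (Equiv.swap 0 1) := weylGL_mul_elemGL _ _ _ _ _
        show ρ (elemGL 0 2 _ t) (ρ (elemGL 0 1 _ s) (ρ (weylGL (ZMod p) (Equiv.swap 0 1)) v)) =
          ρ (elemGL 0 1 _ s) (ρ (weylGL (ZMod p) (Equiv.swap 0 1)) v)
        rw [← rho_mul ρ (elemGL 0 2 _ t), elemGL_mul_comm_left, rho_mul,
          ← rho_mul ρ (elemGL 0 2 _ t), ← h1, rho_mul, hv.1 1 2 (by decide)]
      · right
        intro s
        have h1 : ∀ t : ZMod p, weylGL (ZMod p) (Equiv.swap 0 1) * elemGL 1 2 (by decide) t =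
          elemGL 0 2 (by decide) t * weylGL (ZMod p) (Equiv.swap 0 1) :=
            fun t => weylGL_mul_elemGL _ _ _ _ _
        have h2 : weylGL (ZMod p) (Equiv.swap 0 1) * elemGL 0 2 (by decide) t =
          elemGL 1 2 (by decide) t * weylGL (ZMod p) (Equiv.swap 0 1) := weylGL_mul_elemGL _ _ _ _ _
        have h3 : elemGL 1 2 (by decide) t * elemGL 0 1 (by decide) s =
            elemGL 0 1 (by decide) s * elemGL 1 2 (by decide) t *
              elemGL 0 2 (by decide) (-(s * t)) := by
          rw [elemGL_commutator 0 1 2 (by decide) (by decide) (by decide), mul_assoc _ _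
            (elemGL 0 2 _ _), ← elemGL_add, add_neg_cancel, elemGL_zero, mul_one]
        show ρ (elemGL 1 2 _ t) (ρ (elemGL 0 1 _ s) (ρ (weylGL (ZMod p) (Equiv.swap 0 1)) v)) =
          ρ (elemGL 0 1 _ s) (ρ (weylGL (ZMod p) (Equiv.swap 0 1)) v)
        rw [← rho_mul ρ (elemGL 1 2 _ t), h3, rho_mul, rho_mul, ← rho_mul ρ (elemGL 0 2 _ _), ← h1,
          rho_mul, hv.1 1 2 (by decide), ← rho_mul ρ (elemGL 1 2 _ t), ← h2, rho_mul,
          hv.1 0 2 (by decide)]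
      · right
        intro s
        have h1 : ∀ t : ZMod p, weylGL (ZMod p) (Equiv.swap 1 2) * elemGL 0 1 (by decide) t =
          elemGL 0 2 (by decide) t * weylGL (ZMod p) (Equiv.swap 1 2) :=
            fun t => weylGL_mul_elemGL _ _ _ _ _
        have h2 : weylGL (ZMod p) (Equiv.swap 1 2) * elemGL 0 2 (by decide) t =
          elemGL 0 1 (by decide) t * weylGL (ZMod p) (Equiv.swap 1 2) := weylGL_mul_elemGL _ _ _ _ _
        show ρ (elemGL 0 1 _ t) (ρ (elemGL 1 2 _ s) (ρ (weylGL (ZMod p) (Equiv.swap 1 2)) v)) =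
          ρ (elemGL 1 2 _ s) (ρ (weylGL (ZMod p) (Equiv.swap 1 2)) v)
        rw [← rho_mul ρ (elemGL 0 1 _ t), elemGL_commutator 0 1 2 (by decide) (by decide)
          (by decide), rho_mul, rho_mul, ← rho_mul ρ (elemGL 0 2 _ _), ← h1,
          rho_mul, hv.1 0 1 (by decide), ← rho_mul ρ (elemGL 0 1 _ t), ← h2, rho_mul,
          hv.1 0 2 (by decide)]
      · right
        intro s
        have h1 : weylGL (ZMod p) (Equiv.swap 1 2) * elemGL 0 1 (by decide) t =
          elemGL 0 2 (by decide) t * weylGL (ZMod p) (Equiv.swap 1 2) := weylGL_mul_elemGL _ _ _ _ _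
        show ρ (elemGL 0 2 _ t) (ρ (elemGL 1 2 _ s) (ρ (weylGL (ZMod p) (Equiv.swap 1 2)) v)) =
          ρ (elemGL 1 2 _ s) (ρ (weylGL (ZMod p) (Equiv.swap 1 2)) v)
        rw [← rho_mul ρ (elemGL 0 2 _ t), elemGL_mul_comm_right, rho_mul,
          ← rho_mul ρ (elemGL 0 2 _ t), ← h1, rho_mul, hv.1 0 1 (by decide)]
      · exact Or.inl ⟨rfl, rfl⟩
    rcases key with ⟨rfl, rfl⟩ | key
    · simp only [← rho_mul ρ (elemGL a b _ t), ← elemGL_add]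
      exact Fintype.sum_equiv (Equiv.addLeft t) _ _ fun s => rfl
    · exact Finset.sum_congr rfl fun s _ => key s
  · intro d
    rw [heckeT_apply, map_sum, Finset.smul_sum]
    refine Fintype.sum_equiv ((Units.mulLeft (d i)).trans (Units.mulRight (d j)⁻¹)) _ _
      fun s => ?_
    rw [← rho_mul, torusGL_mul_elemGL, rho_mul, ← rho_mul ρ (torusGL d), torusGL_mul_weylGL,
      rho_mul, hv.2, map_smul, map_smul]
    rfl

theorem sum_rootTorus (hη : η ≠ 1) {i j : Fin 3} (hij : i ≠ j) (l : Fin 3) :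
    ∑ u : (ZMod p)ˣ, (η (rootTorus i j u l) : kb p) = if l = i ∨ l = j then 0 else -1 := by
  have hη' : (Units.coeHom (kb p)).comp η ≠ 1 := by
    intro h
    apply hη
    ext u
    exact DFunLike.congr_fun h u
  have h0 := sum_hom_units_eq_zero _ hη'
  split_ifs with h
  · rcases h with rfl | rfl
    · simpa [rootTorus] using h0
    · simp only [rootTorus, if_neg hij.symm, if_true]
      rw [← h0]
      exact Fintype.sum_equiv ((Equiv.inv _).trans (Equiv.neg _)) _ _ fun u => rfl
  · push Not at h
    simp only [rootTorus, if_neg h.1, if_neg h.2, map_one, Units.val_one, Finset.sum_const,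
      Finset.card_univ, ZMod.card_units, nsmul_eq_mul, mul_one]
    rw [Nat.cast_sub (Fact.out : p.Prime).one_le, CharP.cast_eq_zero]
    simp

theorem rootTorus_inv (i j : Fin 3) (u : (ZMod p)ˣ) :
    rootTorus i j u⁻¹ = (rootTorus i j u)⁻¹ := by
  funext k
  simp only [rootTorus, Pi.inv_apply]
  split_ifs <;> simp

theorem sum_const_zmod (v : V) : ∑ _t : ZMod p, v = 0 := by
  rw [Finset.sum_const, Finset.card_univ, ZMod.card, ← Nat.cast_smul_eq_nsmul (kb p),
    CharP.cast_eq_zero, zero_smul]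

theorem heckeT_heckeT (hη : η ≠ 1) {l : Fin 3} {v : V} (hv : v ∈ eigU ρ η l) {i j : Fin 3}
    (hij : i < j) :
    heckeT ρ i j hij.ne (heckeT ρ i j hij.ne v) =
      (if l = i ∨ l = j then 0 else -1 : kb p) • heckeT ρ i j hij.ne v := by
  have h1 : ρ (weylGL (ZMod p) (Equiv.swap i j)) (heckeT ρ i j hij.ne v) =
      v + ∑ u : (ZMod p)ˣ, (η (rootTorus i j u⁻¹ l) : kb p)⁻¹ •
        ρ (elemGL i j hij.ne (↑u⁻¹ : ZMod p)) (ρ (weylGL (ZMod p) (Equiv.swap i j)) v) := by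
    rw [heckeT_apply, map_sum, sum_eq_zero_add_sum_units]
    simp only [elemGL_zero, map_one, End.one_apply, rho_weyl_swap_swap]
    congr 1
    refine Finset.sum_congr rfl fun u _ => ?_
    rw [rho_elemGL_weyl hv hij, rho_elemGL_weyl hv hij, map_smul, rho_weyl_elemGL hv hij, smul_smul,
      smul_smul, inv_inv, inv_mul_cancel₀ (Units.ne_zero _), one_smul, rootTorus_inv,
      Pi.inv_apply, map_inv, Units.mul_inv, one_smul]
  have h2 : ∀ s : ZMod p, ∑ t, ρ (elemGL i j hij.ne t) (ρ (elemGL i j hij.ne s)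
      (ρ (weylGL (ZMod p) (Equiv.swap i j)) v)) = heckeT ρ i j hij.ne v := by
    intro s
    rw [heckeT_apply]
    refine Fintype.sum_equiv (Equiv.addRight s) _ _ fun t => ?_
    rw [← rho_mul, ← elemGL_add]
    rfl
  have h3 : ∑ t, ρ (elemGL i j hij.ne t) v = 0 := by
    rw [Finset.sum_congr rfl fun t _ => hv.1 i j hij t, sum_const_zmod]
  rw [heckeT_apply, h1]
  simp only [map_add, map_sum, map_smul, Finset.sum_add_distrib]
  rw [h3, zero_add, Finset.sum_comm]
  simp only [← Finset.smul_sum, h2]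
  rw [← Finset.sum_smul]
  congr 1
  rw [← sum_rootTorus hη hij.ne l]
  refine Finset.sum_congr rfl fun u _ => ?_
  rw [rootTorus_inv, Pi.inv_apply, map_inv, Units.val_inv_eq_inv_val, inv_inv]

/-- The braid relation between the two simple Hecke operators. -/
theorem heckeT_braid (v : V) :
    heckeT ρ 0 1 (by decide) (heckeT ρ 1 2 (by decide) (heckeT ρ 0 1 (by decide) v)) =
      heckeT ρ 1 2 (by decide) (heckeT ρ 0 1 (by decide) (heckeT ρ 1 2 (by decide) v)) := by
  set w := weylGL (ZMod p) (Equiv.swap 0 1 * Equiv.swap 1 2 * Equiv.swap 0 1) with hw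
  have hw' : w = weylGL (ZMod p) (Equiv.swap 1 2 * Equiv.swap 0 1 * Equiv.swap 1 2) := by
    rw [hw, show (Equiv.swap 0 1 * Equiv.swap 1 2 * Equiv.swap 0 1 : Equiv.Perm (Fin 3)) =
      Equiv.swap 1 2 * Equiv.swap 0 1 * Equiv.swap 1 2 by decide]
  have e1 : ∀ a b c : ZMod p,
      elemGL 0 1 (by decide) a * weylGL (ZMod p) (Equiv.swap 0 1) *
        (elemGL 1 2 (by decide) b * weylGL (ZMod p) (Equiv.swap 1 2) *
          (elemGL 0 1 (by decide) c * weylGL (ZMod p) (Equiv.swap 0 1))) =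
      elemGL 0 1 (by decide) a * elemGL 0 2 (by decide) b * elemGL 1 2 (by decide) c * w := by
    intro a b c
    have h1 : weylGL (ZMod p) (Equiv.swap 1 2) * elemGL 0 1 (by decide) c =
      elemGL 0 2 (by decide) c * weylGL (ZMod p) (Equiv.swap 1 2) := weylGL_mul_elemGL _ _ _ _ _
    have h2 : weylGL (ZMod p) (Equiv.swap 0 1) * elemGL 0 2 (by decide) c =
      elemGL 1 2 (by decide) c * weylGL (ZMod p) (Equiv.swap 0 1) := weylGL_mul_elemGL _ _ _ _ _
    have h3 : weylGL (ZMod p) (Equiv.swap 0 1) * elemGL 1 2 (by decide) b =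
      elemGL 0 2 (by decide) b * weylGL (ZMod p) (Equiv.swap 0 1) := weylGL_mul_elemGL _ _ _ _ _
    rw [hw, weylGL_mul, weylGL_mul]
    simp only [mul_assoc]
    rw [← mul_assoc (weylGL _ (Equiv.swap 1 2)), h1]
    simp only [mul_assoc]
    rw [← mul_assoc (weylGL _ (Equiv.swap 0 1)), h3]
    simp only [mul_assoc]
    rw [← mul_assoc (weylGL _ (Equiv.swap 0 1)), h2]
    simp only [mul_assoc]
  have e2 : ∀ a b c : ZMod p,
      elemGL 1 2 (by decide) a * weylGL (ZMod p) (Equiv.swap 1 2) *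
        (elemGL 0 1 (by decide) b * weylGL (ZMod p) (Equiv.swap 0 1) *
          (elemGL 1 2 (by decide) c * weylGL (ZMod p) (Equiv.swap 1 2))) =
      elemGL 0 1 (by decide) c * elemGL 0 2 (by decide) (b - c * a) * elemGL 1 2 (by decide) a *
        w := by
    intro a b c
    have h1 : weylGL (ZMod p) (Equiv.swap 0 1) * elemGL 1 2 (by decide) c =
      elemGL 0 2 (by decide) c * weylGL (ZMod p) (Equiv.swap 0 1) := weylGL_mul_elemGL _ _ _ _ _
    have h2 : weylGL (ZMod p) (Equiv.swap 1 2) * elemGL 0 2 (by decide) c =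
      elemGL 0 1 (by decide) c * weylGL (ZMod p) (Equiv.swap 1 2) := weylGL_mul_elemGL _ _ _ _ _
    have h3 : weylGL (ZMod p) (Equiv.swap 1 2) * elemGL 0 1 (by decide) b =
      elemGL 0 2 (by decide) b * weylGL (ZMod p) (Equiv.swap 1 2) := weylGL_mul_elemGL _ _ _ _ _
    rw [hw', weylGL_mul, weylGL_mul]
    simp only [mul_assoc]
    rw [← mul_assoc (weylGL _ (Equiv.swap 0 1)), h1]
    simp only [mul_assoc]
    rw [← mul_assoc (weylGL _ (Equiv.swap 1 2)), h3]
    simp only [mul_assoc]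
    rw [← mul_assoc (weylGL _ (Equiv.swap 1 2)), h2]
    simp only [← mul_assoc]
    congr 3
    ext k l
    fin_cases k <;> fin_cases l <;>
      simp [Matrix.mul_apply, Fin.sum_univ_three, elemGL_apply]
  have L : ∀ (i j : Fin 3) (h : i ≠ j) (i' j' : Fin 3) (h' : i' ≠ j') (v : V),
      heckeT ρ i j h (heckeT ρ i' j' h' (heckeT ρ i j h v)) = ∑ c : ZMod p, ∑ b : ZMod p,
        ∑ a : ZMod p, ρ (elemGL i j h a * weylGL (ZMod p) (Equiv.swap i j) *
        (elemGL i' j' h' b * weylGL (ZMod p) (Equiv.swap i' j') *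
          (elemGL i j h c * weylGL (ZMod p) (Equiv.swap i j)))) v := by
    intro i j h i' j' h' v
    simp only [heckeT, LinearMap.sum_apply, map_sum, rho_mul]
  rw [L, L]
  simp only [e1, e2]
  have shift : ∀ a c : ZMod p,
      ∑ b, ρ (elemGL 0 1 (by decide) c * elemGL 0 2 (by decide) (b - c * a) *
        elemGL 1 2 (by decide) a * w) v =
      ∑ b, ρ (elemGL 0 1 (by decide) c * elemGL 0 2 (by decide) b *
        elemGL 1 2 (by decide) a * w) v := fun a c =>
    Fintype.sum_equiv (Equiv.subRight (c * a)) _ _ fun _ => rfl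
  rw [Finset.sum_congr rfl fun c _ => Finset.sum_comm, Finset.sum_comm]
  refine Eq.trans ?_ (Finset.sum_congr rfl fun c _ => Finset.sum_comm).symm
  simp only [shift]

end FiniteHecke

section FiniteWeight

open Module

variable {p}
variable {V : Type} [AddCommGroup V] [Module (kb p) V]
variable {ρ : Representation (kb p) (Gk p 3) V} {η : (ZMod p)ˣ →* (kb p)ˣ}

theorem rho_weyl_mem_span {l : Fin 3} {v : V} (hv : v ∈ eigU ρ η l) {i j : Fin 3} (hij : i < j)
    {c : kb p} (hc : heckeT ρ i j hij.ne v = c • v) (a : ZMod p) :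
    ρ (weylGL (ZMod p) (Equiv.swap i j)) (ρ (elemGL j i hij.ne' a) v) ∈
      Submodule.span (kb p) (Set.range fun t => ρ (elemGL j i hij.ne' t) v) := by
  have hmem : ∀ t, ρ (elemGL j i hij.ne' t) v ∈
      Submodule.span (kb p) (Set.range fun t => ρ (elemGL j i hij.ne' t) v) :=
    fun t => Submodule.subset_span ⟨t, rfl⟩
  by_cases ha : a = 0
  · subst ha
    rw [heckeT_eq hv hij] at hc
    have h0 := hmem 0
    rw [elemGL_zero, map_one, End.one_apply] at h0 ⊢
    rw [eq_sub_of_add_eq hc]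
    exact Submodule.sub_mem _ (Submodule.smul_mem _ _ h0)
      (Submodule.sum_mem _ fun u _ => Submodule.smul_mem _ _ (hmem _))
  · have := rho_weyl_elemGL hv hij (Units.mk0 a ha)
    rw [Units.val_mk0] at this
    rw [this]
    exact Submodule.smul_mem _ _ (hmem _)

theorem gl_induction {P : Gk p 3 → Prop} (ht : ∀ d, P (torusGL d))
    (he : ∀ i j h t, P (elemGL i j h t)) (hm : ∀ g h, P g → P h → P (g * h)) (g : Gk p 3) :
    P g := by
  have key := Matrix.diagonal_transvection_induction_of_det_ne_zero
    (fun M : Matrix (Fin 3) (Fin 3) (ZMod p) => ∀ g : Gk p 3, (g : Matrix _ _ _) = M → P g)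
    (g : Matrix _ _ _) g.det.ne_zero ?_ ?_ ?_
  · exact key g rfl
  · intro D hD g hg
    rw [Matrix.det_diagonal, Finset.prod_ne_zero_iff] at hD
    have : g = torusGL fun i => Units.mk0 (D i) (hD i (Finset.mem_univ i)) := by
      ext a b
      rw [hg, torusGL_apply, Matrix.diagonal_apply]
      rfl
    rw [this]
    exact ht _
  · intro t g hg
    have : g = elemGL t.i t.j t.hij t.c := Units.ext hg
    rw [this]
    exact he _ _ _ _
  · intro A B hA hB hPA hPB g hg
    have : g = Matrix.GeneralLinearGroup.mkOfDetNeZero A hA *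
        Matrix.GeneralLinearGroup.mkOfDetNeZero B hB := Units.ext hg
    rw [this]
    exact hm _ _ (hPA _ rfl) (hPB _ rfl)

variable (ρ η) in
/-- Nonzero vectors of `eigU` which are eigenvectors of both simple Hecke operators. -/
structure IsSimEig (l : Fin 3) (v : V) : Prop where
  mem : v ∈ eigU ρ η l
  ne : v ≠ 0
  left : ∃ c : kb p, heckeT ρ 0 1 (by decide) v = c • v
  right : ∃ c : kb p, heckeT ρ 1 2 (by decide) v = c • v

variable (ρ) in
/-- The span of the translates of `v` by the lower triangular unipotent group. -/
def lowerSpan (v : V) : Submodule (kb p) V :=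
  Submodule.span (kb p) {x | ∃ g, IsLowerUni g ∧ ρ g v = x}

theorem mem_lowerSpan {g : Gk p 3} (hg : IsLowerUni g) (v : V) : ρ g v ∈ lowerSpan ρ v :=
  Submodule.subset_span ⟨g, hg, rfl⟩

theorem lowerSpan_stable {v : V} {h : Gk p 3}
    (H : ∀ g, IsLowerUni g → ρ h (ρ g v) ∈ lowerSpan ρ v) {x : V} (hx : x ∈ lowerSpan ρ v) :
    ρ h x ∈ lowerSpan ρ v := by
  have : lowerSpan ρ v ≤ (lowerSpan ρ v).comap (ρ h) := by
    refine Submodule.span_le.2 ?_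
    rintro _ ⟨g, hg, rfl⟩
    exact H g hg
  exact this hx

theorem mul_elemGL_apply_eq_zero {g : Gk p 3} (hg : IsLowerUni g) {i j : Fin 3} (hij : i < j) :
    (g * elemGL j i hij.ne' (-(g j i))) j i = 0 := by
  obtain ⟨h1, h2, h3, h4, h5, h6⟩ := hg
  fin_cases i <;> fin_cases j <;> first | exact absurd hij (by decide) | skip
  all_goals simp [Matrix.mul_apply, Fin.sum_univ_three, elemGL_apply, *]

theorem IsLowerUni.elemGL_mul_apply {g : Gk p 3} (hg : IsLowerUni g) {i j : Fin 3}
    (hij : j.val = i.val + 1) (u : ZMod p) :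
    (elemGL j i (lt_of_val_eq_succ hij).ne' u * g) j i = u + g j i := by
  obtain ⟨h1, h2, h3, h4, h5, h6⟩ := hg
  fin_cases i <;> fin_cases j <;> simp at hij <;>
    simp [Matrix.mul_apply, Fin.sum_univ_three, elemGL_apply, h1, h2, h4]

theorem lowerSpan_swap_stable {l : Fin 3} {v : V} (hv : v ∈ eigU ρ η l) {i j : Fin 3}
    (hij : j.val = i.val + 1) {c : kb p}
    (hc : heckeT ρ i j (lt_of_val_eq_succ hij).ne v = c • v) {x : V} (hx : x ∈ lowerSpan ρ v) :
    ρ (weylGL (ZMod p) (Equiv.swap i j)) x ∈ lowerSpan ρ v := by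
  have hlt := lt_of_val_eq_succ hij
  refine lowerSpan_stable (fun g hg => ?_) hx
  set w := weylGL (ZMod p) (Equiv.swap i j) with hw
  set y := g * elemGL j i hlt.ne' (-(g j i)) with hy
  have hyl : IsLowerUni y := hg.mul (isLowerUni_elemGL hlt _)
  have hy0 : IsLowerUni (w * y * w) := hyl.swap hij (mul_elemGL_apply_eq_zero hg hlt)
  have hgy : w * g = (w * y * w) * (w * elemGL j i hlt.ne' (g j i)) := by
    have h1 : w * w = 1 := weylGL_swap_mul_self _ _
    have h2 : elemGL j i hlt.ne' (-(g j i)) * elemGL j i hlt.ne' (g j i) = 1 := by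
      rw [← elemGL_add, neg_add_cancel, elemGL_zero]
    calc w * g = w * (g * (elemGL j i hlt.ne' (-(g j i)) * elemGL j i hlt.ne' (g j i))) := by
          rw [h2, mul_one]
      _ = w * y * 1 * elemGL j i hlt.ne' (g j i) := by rw [hy]; group
      _ = _ := by rw [← h1]; group
  rw [← rho_mul, hgy, rho_mul, rho_mul ρ w]
  have hle : Submodule.span (kb p) (Set.range fun t => ρ (elemGL j i hlt.ne' t) v) ≤
      (lowerSpan ρ v).comap (ρ (w * y * w)) := by
    refine Submodule.span_le.2 ?_
    rintro _ ⟨t, rfl⟩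
    change ρ (w * y * w) (ρ (elemGL j i hlt.ne' t) v) ∈ lowerSpan ρ v
    rw [← rho_mul]
    exact mem_lowerSpan (hy0.mul (isLowerUni_elemGL hlt t)) v
  exact hle (rho_weyl_mem_span hv hlt hc _)

theorem lowerSpan_eq_top (hirr : IsIrred p 3 ρ) {l : Fin 3} {v : V} (hv : IsSimEig ρ η l v) :
    lowerSpan ρ v = ⊤ := by
  obtain ⟨a, ha⟩ := hv.left
  obtain ⟨b, hb⟩ := hv.right
  have s1 : ∀ x ∈ lowerSpan ρ v, ρ (weylGL (ZMod p) (Equiv.swap 0 1)) x ∈ lowerSpan ρ v :=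
    fun x hx => lowerSpan_swap_stable hv.mem rfl ha hx
  have s2 : ∀ x ∈ lowerSpan ρ v, ρ (weylGL (ZMod p) (Equiv.swap 1 2)) x ∈ lowerSpan ρ v :=
    fun x hx => lowerSpan_swap_stable hv.mem rfl hb hx
  have s3 : ∀ x ∈ lowerSpan ρ v, ρ (weylGL (ZMod p) (Equiv.swap 0 2)) x ∈ lowerSpan ρ v := by
    intro x hx
    rw [show (Equiv.swap 0 2 : Equiv.Perm (Fin 3)) =
      Equiv.swap 0 1 * (Equiv.swap 1 2 * Equiv.swap 0 1) by decide, weylGL_mul, weylGL_mul,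
      rho_mul, rho_mul]
    exact s1 _ (s2 _ (s1 _ hx))
  have hlow : ∀ (i j : Fin 3) (h : j < i) (t : ZMod p), ∀ x ∈ lowerSpan ρ v,
      ρ (elemGL i j h.ne' t) x ∈ lowerSpan ρ v := by
    intro i j h t x hx
    refine lowerSpan_stable (fun g hg => ?_) hx
    rw [← rho_mul]
    exact mem_lowerSpan ((isLowerUni_elemGL h t).mul hg) v
  have hup : ∀ (i j : Fin 3) (h : i < j) (t : ZMod p),
      (∀ x ∈ lowerSpan ρ v, ρ (weylGL (ZMod p) (Equiv.swap i j)) x ∈ lowerSpan ρ v) →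
      ∀ x ∈ lowerSpan ρ v, ρ (elemGL i j h.ne t) x ∈ lowerSpan ρ v := by
    intro i j h t hs x hx
    have h1 := weylGL_mul_elemGL (Equiv.swap i j) j i h.ne' t
    simp only [Equiv.swap_apply_left, Equiv.swap_apply_right] at h1
    have h2 : elemGL i j h.ne t = weylGL (ZMod p) (Equiv.swap i j) * (elemGL j i h.ne' t *
        weylGL (ZMod p) (Equiv.swap i j)) := by
      rw [← mul_assoc, h1, mul_assoc, weylGL_swap_mul_self, mul_one]
    rw [h2, rho_mul, rho_mul]
    exact hs _ (hlow _ _ h t _ (hs _ hx))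
  have hstab : ∀ g x, x ∈ lowerSpan ρ v → ρ g x ∈ lowerSpan ρ v := by
    intro g
    refine gl_induction (P := fun g => ∀ x, x ∈ lowerSpan ρ v → ρ g x ∈ lowerSpan ρ v)
      ?_ ?_ ?_ g
    · intro d x hx
      refine lowerSpan_stable (fun g hg => ?_) hx
      have : torusGL d * g = (torusGL d * g * (torusGL d)⁻¹) * torusGL d := by group
      rw [← rho_mul, this, rho_mul, hv.mem.2, map_smul]
      exact Submodule.smul_mem _ _ (mem_lowerSpan (hg.torus d) v)
    · intro i j h t
      rcases lt_or_gt_of_ne h with hlt | hlt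
      · refine hup i j hlt t ?_
        fin_cases i <;> fin_cases j <;> first | exact absurd hlt (by decide) | skip
        · exact s1
        · exact s3
        · exact s2
      · exact hlow i j hlt t
    · intro g h hg hh x hx
      rw [rho_mul]
      exact hg _ (hh _ hx)
  refine (hirr.2 _ hstab).resolve_left fun h => hv.ne ?_
  have := mem_lowerSpan (ρ := ρ) IsLowerUni.one v
  rw [h, map_one] at this
  exact this

theorem IsLowerInv.eq_zero (hirr : IsIrred p 3 ρ) {l : Fin 3} {v : V} (hv : IsSimEig ρ η l v)
    {ℓ : Dual (kb p) V} (hℓ : IsLowerInv ρ ℓ) (h0 : ℓ v = 0) : ℓ = 0 := by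
  have : lowerSpan ρ v ≤ LinearMap.ker ℓ := by
    refine Submodule.span_le.2 ?_
    rintro _ ⟨g, hg, rfl⟩
    exact (hℓ.apply_of_isLowerUni hg v).trans h0
  rw [lowerSpan_eq_top hirr hv] at this
  ext x
  exact this (Submodule.mem_top (x := x))

theorem IsSimEig.exists_functional (hirr : IsIrred p 3 ρ) {l : Fin 3} {v : V}
    (hv : IsSimEig ρ η l v) : ∃ ℓ : Dual (kb p) V, IsLowerInv ρ ℓ ∧ ℓ v ≠ 0 := by
  have : Nontrivial V := ⟨v, 0, hv.ne⟩
  obtain ⟨ℓ, h0, hℓ⟩ := exists_isLowerInv ρ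
  exact ⟨ℓ, hℓ, fun h => h0 (hℓ.eq_zero hirr hv h)⟩

theorem IsLowerInv.eq_smul (hirr : IsIrred p 3 ρ) {l : Fin 3} {v : V}
    (hv : IsSimEig ρ η l v) {ℓ : Dual (kb p) V} (hℓ : IsLowerInv ρ ℓ) (h0 : ℓ v ≠ 0)
    {m : Dual (kb p) V} (hm : IsLowerInv ρ m) :
    m = (m v / ℓ v) • ℓ := by
  rw [← sub_eq_zero]
  refine IsLowerInv.eq_zero hirr hv (fun i j h t x => ?_) ?_
  · simp only [LinearMap.sub_apply, LinearMap.smul_apply, hm i j h t x, hℓ i j h t x]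
  · simp only [LinearMap.sub_apply, LinearMap.smul_apply, smul_eq_mul]
    field_simp
    ring

theorem IsLowerInv.apply_torus (hirr : IsIrred p 3 ρ) {l : Fin 3} {v : V}
    (hv : IsSimEig ρ η l v) {ℓ : Dual (kb p) V} (hℓ : IsLowerInv ρ ℓ) (h0 : ℓ v ≠ 0)
    (d : Fin 3 → (ZMod p)ˣ) (x : V) :
    ℓ (ρ (torusGL d) x) = η (d l) * ℓ x := by
  have hm : IsLowerInv ρ (ℓ ∘ₗ ρ (torusGL d)) := fun i j h t y => by
    rw [LinearMap.comp_apply, ← rho_mul, torusGL_mul_elemGL, rho_mul, hℓ i j h,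
      LinearMap.comp_apply]
  have h1 := LinearMap.congr_fun (IsLowerInv.eq_smul hirr hv hℓ h0 hm) x
  rw [LinearMap.comp_apply, LinearMap.comp_apply, hv.mem.2, map_smul, smul_eq_mul,
    mul_div_assoc, div_self h0, mul_one] at h1
  exact h1

theorem IsLowerInv.apply_eq_zero_of_ne (hirr : IsIrred p 3 ρ) {l : Fin 3} {v : V}
    (hv : IsSimEig ρ η l v) {ℓ : Dual (kb p) V} (hℓ : IsLowerInv ρ ℓ) (h0 : ℓ v ≠ 0)
    (hη : η ≠ 1) {l' : Fin 3} (hl : l' ≠ l) {x : V}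
    (hx : x ∈ eigU ρ η l') : ℓ x = 0 := by
  obtain ⟨u, hu⟩ : ∃ u, η u ≠ 1 := by
    by_contra! h
    exact hη (MonoidHom.ext h)
  have h1 := IsLowerInv.apply_torus hirr hv hℓ h0 (Function.update 1 l u) x
  rw [hx.2, Function.update_of_ne hl, Function.update_self, Pi.one_apply, map_one, Units.val_one,
    one_smul] at h1
  by_contra hne
  refine hu (Units.ext ?_)
  rw [Units.val_one]
  exact mul_right_cancel₀ hne (by rw [one_mul]; exact h1.symm)

theorem IsLowerInv.apply_heckeT (hirr : IsIrred p 3 ρ) {l : Fin 3} {v : V}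
    (hv : IsSimEig ρ η l v) {ℓ : Dual (kb p) V} (hℓ : IsLowerInv ρ ℓ) (h0 : ℓ v ≠ 0)
    {l' : Fin 3} {x : V} (hx : x ∈ eigU ρ η l') (hx0 : ℓ x = 0)
    {i j : Fin 3} (hij : j.val = i.val + 1) :
    ℓ (heckeT ρ i j (lt_of_val_eq_succ hij).ne x) = 0 := by
  have hlt := lt_of_val_eq_succ hij
  set w := weylGL (ZMod p) (Equiv.swap i j) with hw
  have h1 : w * w = 1 := weylGL_swap_mul_self _ _
  let m : Dual (kb p) V := ∑ u, ℓ ∘ₗ ρ (w * elemGL j i hlt.ne' u)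
  have hm_apply : ∀ y, m y = ∑ u, ℓ (ρ w (ρ (elemGL j i hlt.ne' u) y)) := fun y => by
    simp only [m, LinearMap.sum_apply, LinearMap.comp_apply, rho_mul]
  have hm : IsLowerInv ρ m := by
    intro a b hab t y
    rw [hm_apply, hm_apply]
    set g := elemGL a b hab.ne' t with hg
    have hgl : IsLowerUni g := isLowerUni_elemGL hab t
    refine Fintype.sum_equiv (Equiv.addRight (g j i)) _ _ fun u => ?_
    rw [Equiv.coe_addRight]
    have hgu : IsLowerUni (elemGL j i hlt.ne' u * g) := (isLowerUni_elemGL hlt u).mul hgl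
    have hent := hgl.elemGL_mul_apply hij u
    have hz := mul_elemGL_apply_eq_zero hgu hlt
    rw [hent] at hz
    have hl := (hgu.mul (isLowerUni_elemGL hlt (-(u + g j i)))).swap hij hz
    rw [← hℓ.apply_of_isLowerUni hl (ρ w (ρ (elemGL j i hlt.ne' (u + g j i)) y))]
    simp only [← rho_mul]
    refine congrArg (fun g => ℓ (ρ g y)) ?_
    have h2 : elemGL j i hlt.ne' (-(u + g j i)) * elemGL j i hlt.ne' (u + g j i) = 1 := by
      rw [← elemGL_add, neg_add_cancel, elemGL_zero]
    calc w * (elemGL j i hlt.ne' u * g)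
        = w * (elemGL j i hlt.ne' u * g * (elemGL j i hlt.ne' (-(u + g j i)) *
            elemGL j i hlt.ne' (u + g j i))) := by rw [h2, mul_one]
      _ = w * (elemGL j i hlt.ne' u * g * elemGL j i hlt.ne' (-(u + g j i))) * 1 *
            elemGL j i hlt.ne' (u + g j i) := by group
      _ = _ := by rw [← hw, ← h1]; simp only [mul_assoc]
  have hmx : m x = 0 := by
    rw [IsLowerInv.eq_smul hirr hv hℓ h0 hm, LinearMap.smul_apply, hx0, smul_zero]
  have hwx : ℓ (ρ w x) = 0 := by
    rw [hm_apply, sum_eq_zero_add_sum_units, elemGL_zero, map_one, End.one_apply,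
      Finset.sum_eq_zero (s := Finset.univ), add_zero] at hmx
    · exact hmx
    · intro u _
      rw [hw, rho_weyl_elemGL hx hlt, map_smul, hℓ j i hlt, hx0, smul_zero]
  rw [heckeT_eq hx hlt, map_add, hwx, zero_add, map_sum]
  refine Finset.sum_eq_zero fun u _ => ?_
  rw [map_smul, hℓ j i hlt, hx0, smul_zero]

theorem heckeT_one_two_eq_zero (hirr : IsIrred p 3 ρ) (hη : η ≠ 1) {v : V} (hv : v ∈ eigU ρ η 2)
    {c : kb p} (hc : heckeT ρ 0 1 (by decide) v = c • v) : heckeT ρ 1 2 (by decide) v = 0 := by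
  by_contra hne
  set y := heckeT ρ 1 2 (by decide) v with hy
  have hy1 : y ∈ eigU ρ η 1 := heckeT_mem hv rfl
  have hyr : heckeT ρ 1 2 (by decide) y = (0 : kb p) • y :=
    (heckeT_heckeT hη hv (by decide)).trans (by rw [if_pos (by decide)])
  by_cases hyl : heckeT ρ 0 1 (by decide) y = 0
  · have hs : IsSimEig ρ η 1 y := ⟨hy1, hne, ⟨0, by rw [hyl, zero_smul]⟩, ⟨0, hyr⟩⟩
    obtain ⟨ℓ, hℓ, h0⟩ := hs.exists_functional hirr
    have h1 := IsLowerInv.apply_eq_zero_of_ne hirr hs hℓ h0 hη (by decide) hv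
    exact h0 (IsLowerInv.apply_heckeT hirr hs hℓ h0 hv h1 rfl)
  · set z := heckeT ρ 0 1 (by decide) y with hz
    have hz0 : z ∈ eigU ρ η 0 := heckeT_mem hy1 rfl
    have hzl : heckeT ρ 0 1 (by decide) z = (0 : kb p) • z :=
      (heckeT_heckeT hη hy1 (by decide)).trans (by rw [if_pos (by decide)])
    have hzr : heckeT ρ 1 2 (by decide) z = c • z := by
      rw [hz, hy, ← heckeT_braid, hc, map_smul, map_smul]
    have hs : IsSimEig ρ η 0 z := ⟨hz0, hyl, ⟨0, hzl⟩, ⟨c, hzr⟩⟩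
    obtain ⟨ℓ, hℓ, h0⟩ := hs.exists_functional hirr
    have h1 := IsLowerInv.apply_eq_zero_of_ne hirr hs hℓ h0 hη (by decide) hv
    have h2 := IsLowerInv.apply_heckeT hirr hs hℓ h0 hv h1 (i := 1) (j := 2) rfl
    exact h0 (IsLowerInv.apply_heckeT hirr hs hℓ h0 hy1 h2 rfl)

theorem heckeT_zero_one_eq_smul (hirr : IsIrred p 3 ρ) (hη : η ≠ 1) {v : V}
    (hv : v ∈ eigU ρ η 2) :
    ∃ c : kb p, (c = 0 ∨ c = -1) ∧ heckeT ρ 0 1 (by decide) v = c • v := by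
  set v1 := heckeT ρ 0 1 (by decide) v with hv1
  have hv1m : v1 ∈ eigU ρ η 2 := heckeT_mem hv rfl
  have h1 : heckeT ρ 0 1 (by decide) v1 = (-1 : kb p) • v1 :=
    (heckeT_heckeT hη hv (by decide)).trans (by rw [if_neg (by decide)])
  have h2 : heckeT ρ 0 1 (by decide) (v + v1) = (0 : kb p) • (v + v1) := by
    rw [map_add, h1, ← hv1]
    simp
  have hs : ∀ x : V, x ∈ eigU ρ η 2 → x ≠ 0 → ∀ c : kb p,
      heckeT ρ 0 1 (by decide) x = c • x → IsSimEig ρ η 2 x := fun x hx hx0 c hc =>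
    ⟨hx, hx0, ⟨c, hc⟩, ⟨0, by rw [heckeT_one_two_eq_zero hirr hη hx hc, zero_smul]⟩⟩
  by_cases e1 : v1 = 0
  · exact ⟨0, Or.inl rfl, by rw [e1, zero_smul]⟩
  by_cases e2 : v + v1 = 0
  · exact ⟨-1, Or.inr rfl, by rw [neg_smul, one_smul]; exact (neg_eq_of_add_eq_zero_right e2).symm⟩
  have hv2m := (eigU ρ η 2).add_mem hv hv1m
  have s1 := hs _ hv1m e1 _ h1
  have s2 := hs _ hv2m e2 _ h2
  obtain ⟨ℓ, hℓ, h0⟩ := s1.exists_functional hirr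
  have h02 : ℓ (v + v1) ≠ 0 := fun h => h0 (by rw [hℓ.eq_zero hirr s2 h]; rfl)
  set c := ℓ v1 / ℓ (v + v1) with hc
  have hx : v1 - c • (v + v1) ∈ eigU ρ η 2 :=
    (eigU ρ η 2).sub_mem hv1m ((eigU ρ η 2).smul_mem _ hv2m)
  have hx0 : ℓ (v1 - c • (v + v1)) = 0 := by
    rw [map_sub, map_smul, smul_eq_mul, hc, div_mul_cancel₀ _ h02, sub_self]
  have h3 := IsLowerInv.apply_heckeT hirr s1 hℓ h0 hx hx0 (i := 0) (j := 1) rfl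
  rw [map_sub, map_smul, h1, h2] at h3
  exact absurd (by simpa using h3) h0

theorem isSimEig_two (hirr : IsIrred p 3 ρ) (hη : η ≠ 1) {v : V} (hv : v ∈ eigU ρ η 2)
    (hne : v ≠ 0) : IsSimEig ρ η 2 v := by
  obtain ⟨c, -, hc⟩ := heckeT_zero_one_eq_smul hirr hη hv
  exact ⟨hv, hne, ⟨c, hc⟩, ⟨0, by rw [heckeT_one_two_eq_zero hirr hη hv hc, zero_smul]⟩⟩

/-- Only one character of the torus occurs on the invariants of the unipotent group. -/
theorem eigU_eq_zero (hirr : IsIrred p 3 ρ) (hη : η ≠ 1) {v : V} (hv : v ∈ eigU ρ η 2)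
    (hne : v ≠ 0) {l : Fin 3} (hl : l ≠ 2) {x : V} (hx : x ∈ eigU ρ η l) : x = 0 := by
  have s := isSimEig_two hirr hη hv hne
  obtain ⟨ℓ, hℓ, h0⟩ := s.exists_functional hirr
  have hker : ∀ y ∈ eigU ρ η 2, ℓ y = 0 → y = 0 := by
    intro y hy hy0
    by_contra hyne
    exact h0 (by rw [hℓ.eq_zero hirr (isSimEig_two hirr hη hy hyne) hy0]; rfl)
  have hsim : ∀ (l : Fin 3), l ≠ 2 → ∀ y ∈ eigU ρ η l,
      (∃ c : kb p, heckeT ρ 0 1 (by decide) y = c • y) →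
      (∃ c : kb p, heckeT ρ 1 2 (by decide) y = c • y) → y = 0 := by
    intro l hl y hy hy1 hy2
    by_contra hyne
    have hy0 := IsLowerInv.apply_eq_zero_of_ne hirr s hℓ h0 hη hl hy
    exact h0 (by rw [hℓ.eq_zero hirr ⟨hy, hyne, hy1, hy2⟩ hy0]; rfl)
  have h1r : ∀ y ∈ eigU ρ η 1, heckeT ρ 1 2 (by decide) y = 0 := fun y hy =>
    hker _ (heckeT_mem hy rfl) (IsLowerInv.apply_heckeT hirr s hℓ h0 hy
      (IsLowerInv.apply_eq_zero_of_ne hirr s hℓ h0 hη (by decide) hy) rfl)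
  have h0e : ∀ y ∈ eigU ρ η 0, ∀ c : kb p, heckeT ρ 1 2 (by decide) y = c • y → y = 0 := by
    intro y hy c hc
    have hz : heckeT ρ 0 1 (by decide) y ∈ eigU ρ η 1 := heckeT_mem hy rfl
    have hz0 : heckeT ρ 0 1 (by decide) y = 0 := hsim 1 (by decide) _ hz
      ⟨0, (heckeT_heckeT hη hy (by decide)).trans (by rw [if_pos (by decide)])⟩
      ⟨0, by rw [h1r _ hz, zero_smul]⟩
    exact hsim 0 (by decide) y hy ⟨0, by rw [hz0, zero_smul]⟩ ⟨c, hc⟩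
  have h00 : ∀ y ∈ eigU ρ η 0, y = 0 := by
    intro y hy
    have hy1m : heckeT ρ 1 2 (by decide) y ∈ eigU ρ η 0 := heckeT_mem hy rfl
    have hy1 : heckeT ρ 1 2 (by decide) (heckeT ρ 1 2 (by decide) y) =
        (-1 : kb p) • heckeT ρ 1 2 (by decide) y :=
      (heckeT_heckeT hη hy (by decide)).trans (by rw [if_neg (by decide)])
    refine h0e y hy 0 ?_
    rw [h0e _ hy1m _ hy1, zero_smul]
  fin_cases l
  · exact h00 x hx
  · refine hsim 1 (by decide) x hx ⟨0, ?_⟩ ⟨0, by rw [h1r x hx, zero_smul]⟩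
    have hz : heckeT ρ 0 1 (by decide) x ∈ eigU ρ η 0 := heckeT_mem hx rfl
    rw [h00 _ hz, zero_smul]
  · exact absurd rfl hl

/-- The analogue of `eigU_eq_zero` for the unipotent radical of the Borel subgroup attached to
the ordering of the coordinates given by `w`. -/
theorem eq_zero_of_fixed_conj (hirr : IsIrred p 3 ρ) (hη : η ≠ 1) {v : V} (hv : v ∈ eigU ρ η 2)
    (hne : v ≠ 0) (w : Equiv.Perm (Fin 3)) (hw : w 2 ≠ 2) {x : V}
    (hx : ∀ (i j : Fin 3) (h : i < j) (t : ZMod p),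
      ρ (elemGL (w i) (w j) (w.injective.ne h.ne) t) x = x)
    (hxd : ∀ d, ρ (torusGL d) x = (η (d 2) : kb p) • x) : x = 0 := by
  have hmem : ρ (weylGL (ZMod p) w⁻¹) x ∈ eigU ρ η (w⁻¹ 2) := by
    constructor
    · intro i j h t
      have h1 : elemGL i j h.ne t * weylGL (ZMod p) w⁻¹ =
          weylGL (ZMod p) w⁻¹ * elemGL (w i) (w j) (w.injective.ne h.ne) t := by
        rw [weylGL_mul_elemGL]
        simp only [Equiv.Perm.inv_def, Equiv.symm_apply_apply]
      rw [← rho_mul, h1, rho_mul, hx i j h]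
    · intro d
      rw [← rho_mul, torusGL_mul_weylGL, rho_mul, hxd, map_smul]
  have h0 := eigU_eq_zero hirr hη hv hne
    (fun h => hw (by rw [Equiv.Perm.inv_eq_iff_eq] at h; exact h.symm)) hmem
  have : ρ (weylGL (ZMod p) w) (ρ (weylGL (ZMod p) w⁻¹) x) = x := by
    rw [← rho_mul, ← weylGL_mul, mul_inv_cancel, weylGL_one, map_one, End.one_apply]
  rw [← this, h0, map_zero]

end FiniteWeight

section Iwahori

variable {p}

theorem toZMod_eq_zero_iff (x : ℤ_[p]) : PadicInt.toZMod x = 0 ↔ ‖x‖ < 1 := by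
  rw [← RingHom.mem_ker, PadicInt.ker_toZMod, IsLocalRing.mem_maximalIdeal, PadicInt.mem_nonunits]

theorem toZMod_eq_one_iff (x : ℤ_[p]) : PadicInt.toZMod x = 1 ↔ ‖x - 1‖ < 1 := by
  rw [← toZMod_eq_zero_iff, map_sub, map_one, sub_eq_zero]

/-- The unipotent upper triangular matrices. -/
def IsUpperUni {R : Type*} [CommRing R] (g : GL (Fin 3) R) : Prop :=
  g 0 0 = 1 ∧ g 1 1 = 1 ∧ g 2 2 = 1 ∧ g 1 0 = 0 ∧ g 2 0 = 0 ∧ g 2 1 = 0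

section UpperUni

variable {R : Type*} [CommRing R]

theorem IsUpperUni.one : IsUpperUni (1 : GL (Fin 3) R) := by
  simp [IsUpperUni]

theorem IsUpperUni.mul {g h : GL (Fin 3) R} (hg : IsUpperUni g) (hh : IsUpperUni h) :
    IsUpperUni (g * h) := by
  obtain ⟨h1, h2, h3, h4, h5, h6⟩ := hg
  obtain ⟨k1, k2, k3, k4, k5, k6⟩ := hh
  simp [IsUpperUni, Matrix.mul_apply, Fin.sum_univ_three, *]

theorem IsUpperUni.inv {g : GL (Fin 3) R} (hg : IsUpperUni g) : IsUpperUni g⁻¹ := by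
  obtain ⟨h1, h2, h3, h4, h5, h6⟩ := hg
  have key : ∀ a b, (g⁻¹ * g : GL (Fin 3) R) a b = (1 : Matrix (Fin 3) (Fin 3) R) a b := by
    intro a b
    rw [inv_mul_cancel]
    rfl
  generalize g⁻¹ = k at key
  simp only [Matrix.GeneralLinearGroup.coe_mul, Matrix.mul_apply, Fin.sum_univ_three] at key
  have k00 := key 0 0
  have k10 := key 1 0
  have k20 := key 2 0
  simp only [h1, h4, h5, mul_one, mul_zero, add_zero, Matrix.one_apply] at k00 k10 k20
  simp only [if_true] at k00
  rw [if_neg (by decide)] at k10 k20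
  have k11 := key 1 1
  have k21 := key 2 1
  have k22 := key 2 2
  simp only [h2, h6, k10, k20, mul_one, mul_zero, zero_mul, zero_add, add_zero,
    Matrix.one_apply] at k11 k21
  simp only [if_true] at k11
  rw [if_neg (by decide)] at k21
  simp only [h3, k20, k21, mul_one, zero_mul, zero_add, Matrix.one_apply, if_true] at k22
  exact ⟨k00, k11, k22, k10, k20, k21⟩

end UpperUni

theorem mem_I1pre_iff (m : MM p 3) : m ∈ I1pre p 3 ↔ IsUpperUni (redM p 3 m) := by
  constructor
  · rintro ⟨h1, h2⟩
    exact ⟨h2 0, h2 1, h2 2, h1 1 0 (by decide), h1 2 0 (by decide), h1 2 1 (by decide)⟩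
  · rintro ⟨h1, h2, h3, h4, h5, h6⟩
    refine ⟨fun i j hij => ?_, fun i => ?_⟩
    · fin_cases i <;> fin_cases j <;> first | exact absurd hij (by decide) | assumption
    · fin_cases i <;> assumption

theorem one_mem_I1set : (1 : GG p 3) ∈ I1set p 3 :=
  ⟨1, (mem_I1pre_iff 1).2 (by rw [map_one]; exact IsUpperUni.one), map_one _⟩

theorem mul_mem_I1set {x y : GG p 3} (hx : x ∈ I1set p 3) (hy : y ∈ I1set p 3) :
    x * y ∈ I1set p 3 := by
  obtain ⟨m, hm, rfl⟩ := hx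
  obtain ⟨n, hn, rfl⟩ := hy
  rw [mem_I1pre_iff] at hm hn
  exact ⟨m * n, (mem_I1pre_iff _).2 (by rw [map_mul]; exact hm.mul hn), map_mul _ _ _⟩

theorem inv_mem_I1set {x : GG p 3} (hx : x ∈ I1set p 3) : x⁻¹ ∈ I1set p 3 := by
  obtain ⟨m, hm, rfl⟩ := hx
  rw [mem_I1pre_iff] at hm
  exact ⟨m⁻¹, (mem_I1pre_iff _).2 (by rw [map_inv]; exact hm.inv), map_inv _ _⟩

theorem mem_I1set_iff (g : GG p 3) : g ∈ I1set p 3 ↔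
    (∀ i j, ‖g i j‖ ≤ 1) ∧ (∀ i, ‖g i i - 1‖ < 1) ∧ ∀ i j, j < i → ‖g i j‖ < 1 := by
  constructor
  · rintro ⟨m, ⟨h1, h2⟩, rfl⟩
    refine ⟨fun i j => (m i j).norm_le_one, fun i => ?_, fun i j hij => ?_⟩
    · have := (toZMod_eq_one_iff _).1 (h2 i)
      rw [PadicInt.norm_def, PadicInt.coe_sub, PadicInt.coe_one] at this
      exact this
    · exact (toZMod_eq_zero_iff _).1 (h1 i j hij)
  · rintro ⟨h0, h1, h2⟩
    let M : Matrix (Fin 3) (Fin 3) ℤ_[p] := fun i j => ⟨g i j, h0 i j⟩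
    have hd : ∀ i, PadicInt.toZMod (M i i) = 1 := fun i => by
      rw [toZMod_eq_one_iff, PadicInt.norm_def, PadicInt.coe_sub, PadicInt.coe_one]
      exact h1 i
    have hl : ∀ i j, j < i → PadicInt.toZMod (M i j) = 0 := fun i j hij => by
      rw [toZMod_eq_zero_iff]
      exact h2 i j hij
    have hdet : IsUnit M.det := by
      by_contra hn
      rw [PadicInt.not_isUnit_iff, ← toZMod_eq_zero_iff, Matrix.det_fin_three] at hn
      simp only [map_sub, map_add, map_mul, hd, hl 1 0 (by decide), hl 2 0 (by decide),
        hl 2 1 (by decide)] at hn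
      simp at hn
    refine ⟨Matrix.GeneralLinearGroup.mk'' M hdet, ⟨fun i j hij => hl i j hij, hd⟩, ?_⟩
    ext i j
    rfl

theorem elemGL_mem_I1set {i j : Fin 3} (h : i ≠ j) {t : ℚ_[p]} (ht : ‖t‖ ≤ 1)
    (hij : j < i → ‖t‖ < 1) : elemGL i j h t ∈ I1set p 3 := by
  rw [mem_I1set_iff]
  refine ⟨fun a b => ?_, fun a => ?_, fun a b hab => ?_⟩
  · rw [elemGL_apply]
    by_cases hab : a = b
    · subst hab
      rw [if_pos rfl, if_neg (fun hh => h (hh.1.trans hh.2.symm)), add_zero, norm_one]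
    · rw [if_neg hab, zero_add]
      split_ifs
      · exact ht
      · rw [norm_zero]; exact zero_le_one
  · rw [elemGL_apply, if_pos rfl, if_neg (fun hh => h (hh.1.trans hh.2.symm)), add_zero, sub_self,
      norm_zero]
    exact zero_lt_one
  · rw [elemGL_apply, if_neg hab.ne', zero_add]
    split_ifs with hh
    · exact hij (hh.1 ▸ hh.2 ▸ hab)
    · rw [norm_zero]; exact zero_lt_one

theorem norm_diag_of_mem_I1set {g : GG p 3} (hg : g ∈ I1set p 3) (i : Fin 3) : ‖g i i‖ = 1 := by
  have h := ((mem_I1set_iff g).1 hg).2.1 i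
  have h2 : g i i = (g i i - 1) + 1 := by ring
  rw [h2, IsUltrametricDist.norm_add_eq_max_of_norm_ne_norm]
  · rw [norm_one, max_eq_right h.le]
  · rw [norm_one]; exact h.ne

/-- The diagonal matrix `diag(p^{n_0}, p^{n_1}, p^{n_2})`. -/
def powGL (n : Fin 3 → ℤ) : GG p 3 := torusGL fun i => pU p ^ n i

theorem powGL_add (m n : Fin 3 → ℤ) : powGL (p := p) (m + n) = powGL m * powGL n := by
  rw [powGL, powGL, powGL, ← torusGL_mul]
  congr 1
  funext i
  exact zpow_add _ _ _

theorem powGL_inv (n : Fin 3 → ℤ) : (powGL (p := p) n)⁻¹ = powGL (-n) := by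
  rw [powGL, powGL, torusGL_inv]
  congr 1
  funext i
  exact (_root_.zpow_neg _ _).symm

theorem piSc_eq (k : ℤ) : piSc p 3 k = powGL fun _ => k := by
  ext a b
  rw [powGL, torusGL_apply]
  show (algebraMap ℚ_[p] (Matrix (Fin 3) (Fin 3) ℚ_[p]) (pU p ^ k : ℚ_[p]ˣ)) a b = _
  rw [Matrix.algebraMap_matrix_apply]
  rfl

theorem tGL_eq (a : Fin 2 → ℤ) : tGL p 3 a = powGL (expo 3 a) := rfl

theorem permGL_eq (σ : Equiv.Perm (Fin 3)) : permGL p 3 σ = weylGL ℚ_[p] σ := rfl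

theorem coe_pU_zpow (k : ℤ) : ((pU p ^ k : ℚ_[p]ˣ) : ℚ_[p]) = (p : ℚ_[p]) ^ k := by
  rw [Units.val_zpow_eq_zpow_val]
  rfl

theorem powGL_mul_apply (n : Fin 3 → ℤ) (g : GG p 3) (a b : Fin 3) :
    (powGL n * g : GG p 3) a b = (p : ℚ_[p]) ^ n a * g a b := by
  rw [powGL, torusGL_mul_apply, coe_pU_zpow]

theorem mul_powGL_apply (n : Fin 3 → ℤ) (g : GG p 3) (a b : Fin 3) :
    (g * powGL n : GG p 3) a b = g a b * (p : ℚ_[p]) ^ n b := by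
  rw [powGL, mul_torusGL_apply, coe_pU_zpow]

theorem p_ne_zero : (p : ℚ_[p]) ≠ 0 := Nat.cast_ne_zero.2 (Fact.out : p.Prime).ne_zero

theorem powGL_mul_elemGL (n : Fin 3 → ℤ) (i j : Fin 3) (h : i ≠ j) (t : ℚ_[p]) :
    powGL n * elemGL i j h t = elemGL i j h ((p : ℚ_[p]) ^ (n i - n j) * t) * powGL n := by
  rw [powGL, torusGL_mul_elemGL, coe_pU_zpow, ← _root_.zpow_neg, coe_pU_zpow, sub_eq_add_neg,
    zpow_add₀ p_ne_zero]
  congr 2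
  ring

theorem elemGL_mul_powGL (n : Fin 3 → ℤ) (i j : Fin 3) (h : i ≠ j) (t : ℚ_[p]) :
    elemGL i j h t * powGL n = powGL n * elemGL i j h ((p : ℚ_[p]) ^ (n j - n i) * t) := by
  rw [powGL_mul_elemGL, ← mul_assoc, ← zpow_add₀ p_ne_zero]
  simp

theorem powGL_mul_weylGL (n : Fin 3 → ℤ) (σ : Equiv.Perm (Fin 3)) :
    powGL (p := p) n * weylGL ℚ_[p] σ = weylGL ℚ_[p] σ * powGL (n ∘ σ) := by
  rw [powGL, torusGL_mul_weylGL]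
  rfl

theorem powGL_mul_torusGL (n : Fin 3 → ℤ) (d : Fin 3 → ℚ_[p]ˣ) :
    powGL n * torusGL d = torusGL d * powGL n := by
  rw [powGL, ← torusGL_mul, ← torusGL_mul, mul_comm]

theorem iotaM_elemGL (i j : Fin 3) (h : i ≠ j) (z : ℤ_[p]) :
    iotaM p 3 (elemGL i j h z) = elemGL i j h (z : ℚ_[p]) := map_elemGL _ _ _ _ _

theorem redM_elemGL (i j : Fin 3) (h : i ≠ j) (z : ℤ_[p]) :
    redM p 3 (elemGL i j h z) = elemGL i j h (PadicInt.toZMod z) := map_elemGL _ _ _ _ _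

theorem iotaM_weylGL (σ : Equiv.Perm (Fin 3)) :
    iotaM p 3 (weylGL ℤ_[p] σ) = weylGL ℚ_[p] σ := map_weylGL _ _

theorem redM_weylGL (σ : Equiv.Perm (Fin 3)) :
    redM p 3 (weylGL ℤ_[p] σ) = weylGL (ZMod p) σ := map_weylGL _ _

/-- The unit of `ℚ_p` underlying a unit of `ℤ_p`. -/
abbrev coeUnit : ℤ_[p]ˣ →* ℚ_[p]ˣ := Units.map ((PadicInt.Coe.ringHom : ℤ_[p] →+* ℚ_[p]) : ℤ_[p] →* ℚ_[p])

/-- The reduction of a unit of `ℤ_p`. -/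
abbrev redUnit : ℤ_[p]ˣ →* (ZMod p)ˣ :=
  Units.map ((PadicInt.toZMod : ℤ_[p] →+* ZMod p) : ℤ_[p] →* ZMod p)

theorem iotaM_torusGL (d : Fin 3 → ℤ_[p]ˣ) :
    iotaM p 3 (torusGL d) = torusGL fun k => coeUnit (d k) := map_torusGL _ _

theorem redM_torusGL (d : Fin 3 → ℤ_[p]ˣ) :
    redM p 3 (torusGL d) = torusGL fun k => redUnit (d k) := map_torusGL _ _

/-- The lift of an element of the residue field to a natural number in `ℤ_p`. -/
def liftZ (u : ZMod p) : ℤ_[p] := (u.val : ℤ_[p])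

theorem toZMod_liftZ (u : ZMod p) : PadicInt.toZMod (liftZ u) = u := by
  rw [liftZ, map_natCast, ZMod.natCast_zmod_val]

theorem liftZ_zero : liftZ (0 : ZMod p) = 0 := by
  rw [liftZ, ZMod.val_zero, Nat.cast_zero]

theorem isUnit_liftZ (u : (ZMod p)ˣ) : IsUnit (liftZ (u : ZMod p)) := by
  by_contra h
  rw [PadicInt.not_isUnit_iff, ← toZMod_eq_zero_iff, toZMod_liftZ] at h
  exact u.ne_zero h

/-- The lift of a unit of the residue field. -/
def liftU (u : (ZMod p)ˣ) : ℤ_[p]ˣ := (isUnit_liftZ u).unit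

theorem coe_liftU (u : (ZMod p)ˣ) : (liftU u : ℤ_[p]) = liftZ (u : ZMod p) := rfl

theorem redUnit_liftU (u : (ZMod p)ˣ) : redUnit (liftU u) = u :=
  Units.ext (toZMod_liftZ _)

theorem map_rootTorus {R S : Type*} [CommRing R] [CommRing S] (φ : R →+* S) (i j : Fin 3)
    (u : Rˣ) (k : Fin 3) :
    Units.map (φ : R →* S) (rootTorus i j u k) = rootTorus i j (Units.map (φ : R →* S) u) k := by
  simp only [rootTorus]
  split_ifs
  · rfl
  · ext; simp
  · simp

end Iwahori

section Decomposition

variable {p}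

theorem elemGL_mul_apply {R : Type*} [CommRing R] (i j : Fin 3) (h : i ≠ j) (t : R)
    (g : GL (Fin 3) R) (a b : Fin 3) :
    (elemGL i j h t * g : GL (Fin 3) R) a b = g a b + if a = i then t * g j b else 0 := by
  rw [Matrix.GeneralLinearGroup.coe_mul]
  by_cases hai : a = i
  · subst hai
    rw [if_pos rfl]
    exact Matrix.transvection_mul_apply_same a j b t _
  · rw [if_neg hai, add_zero]
    exact Matrix.transvection_mul_apply_of_ne i j a b hai t _

theorem mul_elemGL_apply {R : Type*} [CommRing R] (i j : Fin 3) (h : i ≠ j) (t : R)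
    (g : GL (Fin 3) R) (a b : Fin 3) :
    (g * elemGL i j h t : GL (Fin 3) R) a b = g a b + if b = j then g a i * t else 0 := by
  rw [Matrix.GeneralLinearGroup.coe_mul]
  by_cases hbj : b = j
  · subst hbj
    rw [if_pos rfl, mul_comm]
    exact Matrix.mul_transvection_apply_same i b a t _
  · rw [if_neg hbj, add_zero]
    exact Matrix.mul_transvection_apply_of_ne i j a b hbj t _

theorem fin_three_cases (i a : Fin 3) : a = i ∨ a = i + 1 ∨ a = i + 2 := by
  revert i a; decide

theorem fin_three_ne (i : Fin 3) : i + 1 ≠ i ∧ i + 2 ≠ i ∧ i + 1 ≠ i + 2 := by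
  revert i; decide

theorem exists_clear_column (g : GG p 3) (i j : Fin 3) (hij : g i j ≠ 0)
    (hcol : ∀ a, ‖g a j‖ ≤ ‖g i j‖) :
    ∃ m : MM p 3, ∀ a b, (iotaM p 3 m * g : GG p 3) a b =
      if a = i then g i b else g a b - g a j * g i b / g i j := by
  have hn : ∀ a, ‖-(g a j / g i j)‖ ≤ 1 := fun a => by
    rw [norm_neg, norm_div]
    exact div_le_one_of_le₀ (hcol a) (norm_nonneg _)
  obtain ⟨h1, h2, h3⟩ := fin_three_ne i
  obtain ⟨c, hc⟩ : ∃ c : Fin 3 → ℤ_[p], ∀ a, (c a : ℚ_[p]) = -(g a j / g i j) :=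
    ⟨fun a => ⟨_, hn a⟩, fun a => rfl⟩
  refine ⟨elemGL (i + 1) i h1 (c (i + 1)) * elemGL (i + 2) i h2 (c (i + 2)), fun a b => ?_⟩
  rw [map_mul, iotaM_elemGL, iotaM_elemGL, hc, hc, mul_assoc, elemGL_mul_apply, elemGL_mul_apply,
    elemGL_mul_apply]
  rcases fin_three_cases i a with rfl | rfl | rfl
  · rw [if_neg h2.symm, if_neg h1.symm, if_pos rfl, add_zero, add_zero]
  · rw [if_neg h3, if_pos rfl, if_neg h1, if_neg h2.symm]
    ring
  · rw [if_neg h3.symm, if_pos rfl, if_neg h2]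
    ring

theorem exists_clear_row (g : GG p 3) (i j : Fin 3) (hij : g i j ≠ 0)
    (hrow : ∀ b, ‖g i b‖ ≤ ‖g i j‖) (hrow' : ∀ b, b < j → ‖g i b‖ < ‖g i j‖) :
    ∃ u ∈ I1set p 3, ∀ a b, (g * u : GG p 3) a b =
      if b = j then g a j else g a b - g a j * g i b / g i j := by
  have hn : ∀ b, ‖-(g i b / g i j)‖ ≤ 1 := fun b => by
    rw [norm_neg, norm_div]
    exact div_le_one_of_le₀ (hrow b) (norm_nonneg _)
  have hn' : ∀ b, b < j → ‖-(g i b / g i j)‖ < 1 := fun b hb => by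
    rw [norm_neg, norm_div]
    exact (div_lt_one (norm_pos_iff.2 hij)).2 (hrow' b hb)
  obtain ⟨h1, h2, h3⟩ := fin_three_ne j
  refine ⟨elemGL j (j + 1) h1.symm (-(g i (j + 1) / g i j)) *
    elemGL j (j + 2) h2.symm (-(g i (j + 2) / g i j)),
    mul_mem_I1set (elemGL_mem_I1set _ (hn _) (hn' _)) (elemGL_mem_I1set _ (hn _) (hn' _)),
    fun a b => ?_⟩
  rw [← mul_assoc, mul_elemGL_apply, mul_elemGL_apply, mul_elemGL_apply]
  rcases fin_three_cases j b with rfl | rfl | rfl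
  · rw [if_neg h2.symm, if_neg h1.symm, if_pos rfl, add_zero, add_zero]
  · rw [if_neg h3, if_pos rfl, if_neg h1]
    ring
  · rw [if_neg h3.symm, if_pos rfl, if_neg h2, if_neg h1.symm]
    ring

/-- The `i, j` entry of `g` is the only nonzero entry in its row and in its column. -/
def IsIsolated (g : GG p 3) (i j : Fin 3) : Prop :=
  g i j ≠ 0 ∧ (∀ b, b ≠ j → g i b = 0) ∧ ∀ a, a ≠ i → g a j = 0

theorem exists_isolate (g : GG p 3) (i : Fin 3) (hi : ∀ j, ¬IsIsolated g i j) :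
    ∃ (m : MM p 3) (u : GG p 3) (i : Fin 3), u ∈ I1set p 3 ∧ (∀ j, ¬IsIsolated g i j) ∧
      (∃ j, IsIsolated (iotaM p 3 m * g * u) i j) ∧
      ∀ i' j', IsIsolated g i' j' → IsIsolated (iotaM p 3 m * g * u) i' j' := by
  classical
  let S : Finset (Fin 3 × Fin 3) := Finset.univ.filter fun x => ∀ j, ¬IsIsolated g x.1 j
  obtain ⟨⟨i₀, j⟩, hS, hmax⟩ := S.exists_max_image
    (fun x => toLex (‖g x.1 x.2‖, OrderDual.toDual x.2))
    ⟨(i, i), by simpa [S] using hi⟩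
  have hi₀ : ∀ j, ¬IsIsolated g i₀ j := by simpa [S] using hS
  have hmax' : ∀ a, (∀ j, ¬IsIsolated g a j) → ∀ b, ‖g a b‖ ≤ ‖g i₀ j‖ ∧
      (b < j → ‖g a b‖ < ‖g i₀ j‖) := by
    intro a ha b
    have h := hmax (a, b) (by simpa [S] using ha)
    rw [Prod.Lex.toLex_le_toLex] at h
    rcases h with h | ⟨h, h'⟩
    · exact ⟨h.le, fun _ => h⟩
    · exact ⟨h.le, fun hb => absurd (OrderDual.toDual_le_toDual.1 h') hb.not_ge⟩
  have hne : g i₀ j ≠ 0 := by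
    intro h0
    have hz : ∀ b, g i₀ b = 0 := fun b => norm_le_zero_iff.1 (by
      simpa [h0] using (hmax' i₀ hi₀ b).1)
    have h1 : (g * g⁻¹ : GG p 3) i₀ i₀ = 1 := by rw [mul_inv_cancel]; simp
    rw [Matrix.GeneralLinearGroup.coe_mul, Matrix.mul_apply,
      Finset.sum_eq_zero fun b _ => by rw [hz b, zero_mul]] at h1
    exact zero_ne_one h1
  have hcol : ∀ a, ‖g a j‖ ≤ ‖g i₀ j‖ := by
    intro a
    by_cases ha : ∀ j, ¬IsIsolated g a j
    · exact (hmax' a ha j).1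
    · push Not at ha
      obtain ⟨b, hb⟩ := ha
      have hjb : j ≠ b := by
        rintro rfl
        refine hne (hb.2.2 i₀ ?_)
        rintro rfl
        exact hi₀ _ hb
      rw [hb.2.1 j hjb, norm_zero]
      exact norm_nonneg _
  obtain ⟨m, hm⟩ := exists_clear_column g i₀ j hne hcol
  have hmi : ∀ b, (iotaM p 3 m * g : GG p 3) i₀ b = g i₀ b := fun b => by rw [hm, if_pos rfl]
  have hmj : ∀ a, a ≠ i₀ → (iotaM p 3 m * g : GG p 3) a j = 0 := fun a ha => by
    rw [hm, if_neg ha, mul_div_cancel_right₀ _ hne, sub_self]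
  obtain ⟨u, hu, hu'⟩ := exists_clear_row (iotaM p 3 m * g) i₀ j (by rwa [hmi])
    (fun b => by rw [hmi, hmi]; exact (hmax' i₀ hi₀ b).1)
    (fun b => by rw [hmi, hmi]; exact (hmax' i₀ hi₀ b).2)
  refine ⟨m, u, i₀, hu, hi₀, ⟨j, ?_, ?_, ?_⟩, ?_⟩
  · rwa [hu', if_pos rfl, hmi]
  · intro b hb
    rw [hu', if_neg hb, hmi, hmi, mul_div_cancel_left₀ _ hne, sub_self]
  · intro a ha
    rw [hu', if_pos rfl, hmj a ha]
  · rintro a b ⟨h1, h2, h3⟩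
    have ha : a ≠ i₀ := by
      rintro rfl
      exact hi₀ b ⟨h1, h2, h3⟩
    have hb : b ≠ j := by
      rintro rfl
      exact hne (h3 i₀ ha.symm)
    have hval : ∀ c d, (iotaM p 3 m * g * u : GG p 3) c d =
        if d = j then (if c = i₀ then g i₀ j else 0) else
          if c = i₀ then 0 else g c d - g c j * g i₀ d / g i₀ j := by
      intro c d
      rw [hu', hmi, hmi]
      by_cases hc : c = i₀
      · subst hc
        rw [hmi, hmi, mul_div_cancel_left₀ _ hne, sub_self, if_pos rfl, if_pos rfl]
      · rw [hmj c hc, if_neg hc, if_neg hc, hm, if_neg hc]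
        simp
    refine ⟨?_, fun d hd => ?_, fun c hc => ?_⟩
    · rwa [hval, if_neg hb, if_neg ha, h2 j hb.symm, zero_mul, zero_div, sub_zero]
    · rw [hval, if_neg ha, if_neg ha, h2 d hd, h2 j hb.symm]
      simp
    · rw [hval, if_neg hb, h3 c hc, h3 i₀ ha.symm]
      simp

theorem exists_coeUnit_mul_zpow (x : ℚ_[p]ˣ) : ∃ (u : ℤ_[p]ˣ) (n : ℤ), x = coeUnit u * pU p ^ n := by
  have hp : (p : ℝ) ≠ 0 := Nat.cast_ne_zero.2 (Fact.out : p.Prime).ne_zero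
  have h : ‖(x : ℚ_[p]) * (p : ℚ_[p]) ^ (-(x : ℚ_[p]).valuation)‖ = 1 := by
    rw [norm_mul, Padic.norm_eq_zpow_neg_valuation x.ne_zero, norm_zpow, Padic.norm_p, _root_.inv_zpow',
      ← zpow_add₀ hp]
    simp
  refine ⟨PadicInt.mkUnits h, (x : ℚ_[p]).valuation, Units.ext ?_⟩
  rw [Units.val_mul, coe_pU_zpow]
  show (x : ℚ_[p]) = (x : ℚ_[p]) * (p : ℚ_[p]) ^ (-(x : ℚ_[p]).valuation) * _
  rw [mul_assoc, ← zpow_add₀ p_ne_zero]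
  simp

theorem exists_decomp_of_isIsolated (g : GG p 3) (hg : ∀ i, ∃ j, IsIsolated g i j) :
    ∃ (m : MM p 3) (n : Fin 3 → ℤ), g = iotaM p 3 m * powGL n := by
  choose π hπ using hg
  have hinj : Function.Injective π := by
    intro a b hab
    by_contra hne
    exact (hπ a).1 ((hab ▸ (hπ b).2.2 a hne : g a (π a) = 0))
  let τ : Equiv.Perm (Fin 3) := Equiv.ofBijective π (Finite.injective_iff_bijective.1 hinj)
  have hgτ : g = weylGL ℚ_[p] τ⁻¹ * torusGL fun a => Units.mk0 _ (hπ (τ⁻¹ a)).1 := by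
    rw [weylGL_mul_torusGL]
    ext a b
    rw [torusGL_mul_apply, weylGL_apply]
    by_cases hab : a = τ⁻¹ b
    · have hb : b = π a := by rw [hab]; exact (τ.apply_symm_apply b).symm
      subst hb
      rw [if_pos hab, mul_one]
      simp
    · rw [if_neg hab, mul_zero]
      refine (hπ a).2.1 b fun hb => hab ?_
      rw [hb]
      exact (τ.symm_apply_apply a).symm
  choose e n hen using fun a => exists_coeUnit_mul_zpow (Units.mk0 _ (hπ (τ⁻¹ a)).1)
  refine ⟨weylGL _ τ⁻¹ * torusGL e, n, ?_⟩
  rw [hgτ, map_mul, iotaM_weylGL, iotaM_torusGL, mul_assoc, powGL, ← torusGL_mul]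
  congr 2
  funext a
  exact hen a

theorem exists_decomp (g : GG p 3) : ∃ (m : MM p 3) (n : Fin 3 → ℤ) (u : GG p 3),
    u ∈ I1set p 3 ∧ g = iotaM p 3 m * powGL n * u := by
  classical
  generalize hk : (Finset.univ.filter fun i => ∀ j, ¬IsIsolated g i j).card = k
  induction k using Nat.strong_induction_on generalizing g with
  | _ k ih =>
    by_cases hall : ∀ i, ∃ j, IsIsolated g i j
    · obtain ⟨m, n, h⟩ := exists_decomp_of_isIsolated g hall
      exact ⟨m, n, 1, one_mem_I1set, by rw [mul_one, h]⟩
    · push Not at hall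
      obtain ⟨i, hi⟩ := hall
      obtain ⟨m, u, i₀, hu, hi₀, ⟨j, hj⟩, hpres⟩ := exists_isolate g i hi
      have hlt : (Finset.univ.filter fun i => ∀ j, ¬IsIsolated (iotaM p 3 m * g * u) i j).card <
          k := by
        rw [← hk]
        refine Finset.card_lt_card (Finset.ssubset_iff_of_subset ?_ |>.2 ⟨i₀, ?_, ?_⟩)
        · intro a ha
          rw [Finset.mem_filter] at ha ⊢
          exact ⟨ha.1, fun b hb => ha.2 b (hpres a b hb)⟩
        · simpa using hi₀
        · intro h
          exact (Finset.mem_filter.1 h).2 j hj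
      obtain ⟨m', n, u', hu', h⟩ := ih _ hlt _ rfl
      refine ⟨m⁻¹ * m', n, u' * u⁻¹, mul_mem_I1set hu' (inv_mem_I1set hu), ?_⟩
      have h2 : g = (iotaM p 3 m)⁻¹ * (iotaM p 3 m * g * u) * u⁻¹ := by group
      rw [h2, h, map_mul, map_inv]
      simp only [mul_assoc]

end Decomposition

section Equivariant

variable {p}

theorem powGL_zero : powGL (p := p) (fun _ => 0) = 1 := by
  rw [← torusGL_one, powGL]
  congr 1
  funext i
  exact zpow_zero _

theorem hk_eq_of_isRepSet {V : Type} [AddCommGroup V] {f : GG p 3 → V} (hf : IsI1Inv p 3 f) {g : GG p 3}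
    {R R' : Finset (GG p 3)} (hR : IsRepSet p 3 g R) (hR' : IsRepSet p 3 g R') :
    hk p 3 g R f = hk p 3 g R' f := by
  funext x
  choose φ hφ _ using fun r : R => hR'.2 r (hR.1 r.2)
  rw [hk, hk, ← Finset.sum_coe_sort R, ← Finset.sum_coe_sort R']
  have hinv : ∀ y : GG p 3, y ∈ I1set p 3 ∧ g * y * g⁻¹ ∈ I1set p 3 →
      y⁻¹ ∈ I1set p 3 ∧ g * y⁻¹ * g⁻¹ ∈ I1set p 3 := fun y hy =>
    ⟨inv_mem_I1set hy.1, by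
      have := inv_mem_I1set hy.2
      rwa [_root_.mul_inv_rev, _root_.mul_inv_rev, inv_inv, ← mul_assoc] at this⟩
  have hmul : ∀ y z : GG p 3, y ∈ I1set p 3 ∧ g * y * g⁻¹ ∈ I1set p 3 →
      z ∈ I1set p 3 ∧ g * z * g⁻¹ ∈ I1set p 3 →
      y * z ∈ I1set p 3 ∧ g * (y * z) * g⁻¹ ∈ I1set p 3 := fun y z hy hz =>
    ⟨mul_mem_I1set hy.1 hz.1, by
      have := mul_mem_I1set hy.2 hz.2
      rwa [show g * y * g⁻¹ * (g * z * g⁻¹) = g * (y * z) * g⁻¹ by group] at this⟩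
  refine Fintype.sum_bijective (fun r => (⟨φ r, (hφ r).1⟩ : R')) ⟨?_, ?_⟩ _ _ ?_
  · intro r s hrs
    have hrs' : φ r = φ s := congrArg Subtype.val hrs
    have h1 := hmul _ _ (hinv _ (hφ s).2) (hφ r).2
    rw [hrs', show ((φ s)⁻¹ * (s : GG p 3))⁻¹ * ((φ s)⁻¹ * (r : GG p 3)) =
      (s : GG p 3)⁻¹ * r by group] at h1
    have h0 : (r : GG p 3)⁻¹ * r ∈ I1set p 3 ∧ g * ((r : GG p 3)⁻¹ * r) * g⁻¹ ∈ I1set p 3 := by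
      rw [inv_mul_cancel, mul_one, mul_inv_cancel]
      exact ⟨one_mem_I1set, one_mem_I1set⟩
    exact Subtype.ext ((hR.2 r (hR.1 r.2)).unique ⟨r.2, h0⟩ ⟨s.2, h1⟩)
  · intro r'
    obtain ⟨r, ⟨hr, hr1⟩, -⟩ := hR.2 r' (hR'.1 r'.2)
    refine ⟨⟨r, hr⟩, Subtype.ext ?_⟩
    have h1 := hinv _ hr1
    rw [_root_.mul_inv_rev, inv_inv] at h1
    exact (hR'.2 r (hR.1 hr)).unique (hφ ⟨r, hr⟩) ⟨r'.2, h1⟩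
  · intro r
    rw [← hf _ (hφ r).2.2 (x * φ r * g⁻¹)]
    congr 1
    group

variable {V : Type} [AddCommGroup V] [Module (kb p) V]
variable {ρ : Representation (kb p) (Gk p 3) V}

/-- The left equivariance under `KZ` and right invariance under `I_1`. -/
def IsEqv (ρ : Representation (kb p) (Gk p 3) V) (f : GG p 3 → V) : Prop :=
  (∀ (n : ℤ) (m : MM p 3) (g : GG p 3),
    f (piSc p 3 n * iotaM p 3 m * g) = ρ (redM p 3 m) (f g)) ∧ IsI1Inv p 3 f

namespace IsEqv

variable {f : GG p 3 → V}

theorem apply_iotaM_mul (hf : IsEqv ρ f) (m : MM p 3) (g : GG p 3) :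
    f (iotaM p 3 m * g) = ρ (redM p 3 m) (f g) := by
  rw [← hf.1 0 m g, piSc_eq]
  congr 2
  rw [powGL_zero, one_mul]

theorem apply_powGL_const_mul (hf : IsEqv ρ f) (k : ℤ) (g : GG p 3) : f (powGL (fun _ => k) * g) = f g := by
  have h := hf.1 k 1 g
  rwa [map_one, mul_one, map_one, map_one, Module.End.one_apply, piSc_eq] at h

theorem apply_powGL_mul_elemGL_mul (hf : IsEqv ρ f) (n : Fin 3 → ℤ) (i j : Fin 3) (h : i ≠ j) {s : ℚ_[p]}
    {z : ℤ_[p]} (hz : (p : ℚ_[p]) ^ (n i - n j) * s = z) (g : GG p 3) :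
    f (powGL n * (elemGL i j h s * g)) =
      ρ (elemGL i j h (PadicInt.toZMod z)) (f (powGL n * g)) := by
  rw [← mul_assoc, powGL_mul_elemGL, hz, mul_assoc, ← iotaM_elemGL, hf.apply_iotaM_mul,
    redM_elemGL]

theorem apply_powGL_mul_weylGL_mul (hf : IsEqv ρ f) (n : Fin 3 → ℤ) (σ : Equiv.Perm (Fin 3)) (g : GG p 3) :
    f (powGL n * (weylGL ℚ_[p] σ * g)) = ρ (weylGL (ZMod p) σ) (f (powGL (n ∘ σ) * g)) := by
  rw [← mul_assoc, powGL_mul_weylGL, mul_assoc, ← iotaM_weylGL, hf.apply_iotaM_mul, redM_weylGL]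

theorem apply_powGL_mul_torusGL_mul (hf : IsEqv ρ f) (n : Fin 3 → ℤ) (d : Fin 3 → ℤ_[p]ˣ) (g : GG p 3) :
    f (powGL n * (torusGL (fun k => coeUnit (d k)) * g)) =
      ρ (torusGL fun k => redUnit (d k)) (f (powGL n * g)) := by
  rw [← mul_assoc, powGL_mul_torusGL, mul_assoc, ← iotaM_torusGL, hf.apply_iotaM_mul,
    redM_torusGL]

theorem fixed_powGL (hf : IsEqv ρ f) (n : Fin 3 → ℤ) {i j : Fin 3} (h : i ≠ j)
    (hn : n i < n j ∨ n i = n j ∧ i < j) (t : ZMod p) :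
    ρ (elemGL i j h t) (f (powGL n)) = f (powGL n) := by
  have hs : (p : ℚ_[p]) ^ (n i - n j) * ((p : ℚ_[p]) ^ (n j - n i) * (liftZ t : ℤ_[p])) =
      (liftZ t : ℤ_[p]) := by
    rw [← mul_assoc, ← zpow_add₀ p_ne_zero]
    simp
  have h1 := hf.apply_powGL_mul_elemGL_mul n i j h hs 1
  rw [toZMod_liftZ, mul_one, mul_one] at h1
  rw [← h1]
  have hp1 : (1 : ℝ) < p := Nat.one_lt_cast.2 (Fact.out : p.Prime).one_lt
  have hl : ‖((liftZ t : ℤ_[p]) : ℚ_[p])‖ ≤ 1 := (liftZ t).norm_le_one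
  have hnorm : ‖(p : ℚ_[p]) ^ (n j - n i)‖ = (p : ℝ) ^ (n i - n j) := by
    rw [norm_zpow, Padic.norm_p, _root_.inv_zpow', neg_sub]
  refine hf.2 _ (elemGL_mem_I1set h ?_ fun hji => ?_) _
  · rw [norm_mul, hnorm]
    exact mul_le_one₀ (zpow_le_one_of_nonpos₀ hp1.le (by omega)) (norm_nonneg _) hl
  · rw [norm_mul, hnorm]
    exact mul_lt_one_of_nonneg_of_lt_one_left (zpow_nonneg (by positivity) _)
      (zpow_lt_one_of_neg₀ hp1 (by omega)) hl

theorem eq_of_powGL (hf : IsEqv ρ f) {f' : GG p 3 → V} (hf' : IsEqv ρ f')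
    (h : ∀ n, f (powGL n) = f' (powGL n)) : f = f' := by
  funext g
  obtain ⟨m, n, u, hu, rfl⟩ := exists_decomp g
  rw [hf.2 u hu, hf'.2 u hu, hf.apply_iotaM_mul, hf'.apply_iotaM_mul, h]

end IsEqv

theorem isRepSet_smul {g : GG p 3} {R : Finset (GG p 3)} (hR : IsRepSet p 3 g R) {u : GG p 3}
    (hu : u ∈ I1set p 3) : IsRepSet p 3 g (R.map (Equiv.mulLeft u).toEmbedding) := by
  refine ⟨fun x hx => ?_, fun x hx => ?_⟩
  · obtain ⟨r, hr, rfl⟩ := Finset.mem_map.1 (Finset.mem_coe.1 hx)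
    exact mul_mem_I1set hu (hR.1 hr)
  · obtain ⟨r, ⟨hr, hr1⟩, hr2⟩ := hR.2 (u⁻¹ * x) (mul_mem_I1set (inv_mem_I1set hu) hx)
    refine ⟨u * r, ⟨Finset.mem_map.2 ⟨r, hr, rfl⟩, ?_⟩, ?_⟩
    · rwa [_root_.mul_inv_rev, mul_assoc]
    · rintro y ⟨hy, hy1⟩
      obtain ⟨s, hs, rfl⟩ := Finset.mem_map.1 hy
      simp only [Equiv.coe_toEmbedding, Equiv.coe_mulLeft] at hy1 ⊢
      rw [_root_.mul_inv_rev, mul_assoc] at hy1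
      rw [hr2 s ⟨hs, hy1⟩]

theorem IsEqv.hk {f : GG p 3 → V} (hf : IsEqv ρ f) {g : GG p 3} {R : Finset (GG p 3)}
    (hR : IsRepSet p 3 g R) : IsEqv ρ (hk p 3 g R f) := by
  refine ⟨fun n m x => ?_, fun u hu x => ?_⟩
  · simp only [IH.hk, mul_assoc]
    rw [map_sum]
    refine Finset.sum_congr rfl fun r _ => ?_
    rw [← mul_assoc, hf.1]
  · rw [congrFun (hk_eq_of_isRepSet hf.2 hR (isRepSet_smul hR hu)) x, IH.hk, IH.hk, Finset.sum_map]
    simp only [Equiv.coe_toEmbedding, Equiv.coe_mulLeft, mul_assoc]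

end Equivariant

section RepSets

variable {p}

/-- The matrices `1 + [t] c E_{ij}` for `t` in the residue field. -/
def elemReps (i j : Fin 3) (h : i ≠ j) (c : ℚ_[p]) : Finset (GG p 3) := by
  classical
  exact Finset.univ.image fun t : ZMod p => elemGL i j h (((liftZ t : ℤ_[p]) : ℚ_[p]) * c)

theorem elemGL_left_injective {R : Type*} [CommRing R] (i j : Fin 3) (h : i ≠ j) {s t : R}
    (hst : elemGL i j h s = elemGL i j h t) : s = t := by
  have := congrArg (fun g : GL (Fin 3) R => g i j) hst
  simpa [elemGL_apply, h] using this

theorem liftZ_injective : Function.Injective (liftZ (p := p)) := fun s t h => by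
  rw [← toZMod_liftZ s, h, toZMod_liftZ]

theorem isRepSet_elemReps {g : GG p 3} {i j : Fin 3} (h : i ≠ j) {c : ℚ_[p]} (hc : c ≠ 0)
    (hI : ∀ t, elemGL i j h (((liftZ t : ℤ_[p]) : ℚ_[p]) * c) ∈ I1set p 3)
    (hx : ∀ x ∈ I1set p 3, ‖x i j / c‖ ≤ 1)
    (hy : ∀ y ∈ I1set p 3, g * y * g⁻¹ ∈ I1set p 3 ↔ ‖y i j / c‖ < 1) :
    IsRepSet p 3 g (elemReps i j h c) := by
  have hmem : ∀ r, r ∈ elemReps i j h c ↔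
      ∃ t : ZMod p, elemGL i j h (((liftZ t : ℤ_[p]) : ℚ_[p]) * c) = r := by
    simp [elemReps]
  refine ⟨fun r hr => ?_, fun x hxI => ?_⟩
  · obtain ⟨t, rfl⟩ := (hmem r).1 hr
    exact hI t
  · have hjj := ((mem_I1set_iff x).1 hxI).1 j j
    obtain ⟨W, hW⟩ : ∃ W : ℤ_[p], (W : ℚ_[p]) = x i j / c := ⟨⟨_, hx x hxI⟩, rfl⟩
    obtain ⟨X, hX⟩ : ∃ X : ℤ_[p], (X : ℚ_[p]) = x j j := ⟨⟨_, hjj⟩, rfl⟩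
    have hX1 : PadicInt.toZMod X = 1 := by
      rw [toZMod_eq_one_iff, PadicInt.norm_def, PadicInt.coe_sub, PadicInt.coe_one, hX]
      exact ((mem_I1set_iff x).1 hxI).2.1 j
    have key : ∀ t : ZMod p,
        ((elemGL i j h (((liftZ t : ℤ_[p]) : ℚ_[p]) * c))⁻¹ * x ∈ I1set p 3 ∧
          g * ((elemGL i j h (((liftZ t : ℤ_[p]) : ℚ_[p]) * c))⁻¹ * x) * g⁻¹ ∈ I1set p 3) ↔
        t = PadicInt.toZMod W := by
      intro t
      have hmemI := mul_mem_I1set (inv_mem_I1set (hI t)) hxI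
      rw [and_iff_right hmemI, hy _ hmemI, elemGL_inv, elemGL_mul_apply, if_pos rfl]
      have he : (x i j + -(((liftZ t : ℤ_[p]) : ℚ_[p]) * c) * x j j) / c =
          ((W - liftZ t * X : ℤ_[p]) : ℚ_[p]) := by
        rw [PadicInt.coe_sub, PadicInt.coe_mul, hW, hX]
        field_simp
        ring
      rw [he, ← PadicInt.norm_def, ← toZMod_eq_zero_iff, map_sub, map_mul, hX1, toZMod_liftZ,
        mul_one, sub_eq_zero, eq_comm]
    refine ⟨_, ⟨(hmem _).2 ⟨PadicInt.toZMod W, rfl⟩, (key _).2 rfl⟩, ?_⟩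
    rintro r ⟨hr, hr1⟩
    obtain ⟨t, rfl⟩ := (hmem r).1 hr
    rw [(key t).1 hr1]

theorem hk_apply_eq_sum {V : Type} [AddCommGroup V] {f : GG p 3 → V} (hf : IsI1Inv p 3 f)
    {g : GG p 3} {R : Finset (GG p 3)} (hR : IsRepSet p 3 g R) {i j : Fin 3} (h : i ≠ j)
    {c : ℚ_[p]} (hc : c ≠ 0) (hR' : IsRepSet p 3 g (elemReps i j h c)) (x : GG p 3) :
    hk p 3 g R f x = ∑ t : ZMod p,
      f (x * (elemGL i j h (((liftZ t : ℤ_[p]) : ℚ_[p]) * c) * g⁻¹)) := by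
  classical
  rw [hk_eq_of_isRepSet hf hR hR', hk, elemReps, Finset.sum_image]
  · simp only [mul_assoc]
  · intro s _ t _ hst
    exact liftZ_injective (Subtype.ext
      (mul_right_cancel₀ hc (elemGL_left_injective i j h hst)))

theorem conj_weylGL_mul_powGL_apply (σ : Equiv.Perm (Fin 3)) (e : Fin 3 → ℤ) (y : GG p 3)
    (a b : Fin 3) :
    (weylGL ℚ_[p] σ * powGL e * y * (weylGL ℚ_[p] σ * powGL e)⁻¹ : GG p 3) (σ a) (σ b) =
      (p : ℚ_[p]) ^ (e a - e b) * y a b := by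
  obtain ⟨z, hz⟩ : ∃ z, z = weylGL ℚ_[p] σ * powGL e * y * (weylGL ℚ_[p] σ * powGL e)⁻¹ := ⟨_, rfl⟩
  have h1 : z * weylGL ℚ_[p] σ * powGL e = weylGL ℚ_[p] σ * (powGL e * y) := by
    rw [hz]; group
  have h2 := congrArg (fun g : GG p 3 => g (σ a) b) h1
  simp only [mul_powGL_apply, mul_weylGL_apply, weylGL_mul_apply, powGL_mul_apply,
    Equiv.Perm.inv_def, Equiv.symm_apply_apply] at h2
  rw [← hz, zpow_sub₀ p_ne_zero, div_mul_eq_mul_div, ← h2,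
    mul_div_cancel_right₀ _ (zpow_ne_zero _ p_ne_zero)]

theorem norm_div_p_le_one_iff (x : ℚ_[p]) : ‖x / p‖ ≤ 1 ↔ ‖x‖ < 1 := by
  have h := Padic.norm_le_pow_iff_norm_lt_pow_add_one x (-1)
  rw [neg_add_cancel, zpow_zero] at h
  rw [← h, norm_div, div_le_iff₀ (norm_pos_iff.2 p_ne_zero), one_mul, Padic.norm_p, _root_.zpow_neg_one]

theorem conj_swap_mem_I1set_iff (e : Fin 3 → ℤ) (y : GG p 3) (hy : y ∈ I1set p 3) :
    weylGL ℚ_[p] (Equiv.swap 0 1) * powGL e * y *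
        (weylGL ℚ_[p] (Equiv.swap 0 1) * powGL e)⁻¹ ∈ I1set p 3 ↔
      ‖(p : ℚ_[p]) ^ (e 0 - e 1) * y 0 1‖ < 1 ∧ ‖(p : ℚ_[p]) ^ (e 1 - e 0) * y 1 0‖ ≤ 1 ∧
      ‖(p : ℚ_[p]) ^ (e 2 - e 0) * y 2 0‖ < 1 ∧ ‖(p : ℚ_[p]) ^ (e 2 - e 1) * y 2 1‖ < 1 ∧
      ‖(p : ℚ_[p]) ^ (e 0 - e 2) * y 0 2‖ ≤ 1 ∧ ‖(p : ℚ_[p]) ^ (e 1 - e 2) * y 1 2‖ ≤ 1 := by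
  obtain ⟨z, hz⟩ : ∃ z, z = weylGL ℚ_[p] (Equiv.swap 0 1) * powGL e * y *
        (weylGL ℚ_[p] (Equiv.swap 0 1) * powGL e)⁻¹ := ⟨_, rfl⟩
  have h : ∀ a b, z (Equiv.swap 0 1 a) (Equiv.swap 0 1 b) = (p : ℚ_[p]) ^ (e a - e b) * y a b := by
    rw [hz]
    exact conj_weylGL_mul_powGL_apply _ e y
  have hyd := ((mem_I1set_iff y).1 hy).2.1
  have hz00 : z 0 0 = y 1 1 := by simpa using h 1 1
  have hz11 : z 1 1 = y 0 0 := by simpa using h 0 0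
  have hz22 : z 2 2 = y 2 2 := by simpa [Equiv.swap_apply_def] using h 2 2
  have hz10 := h 0 1
  have hz01 := h 1 0
  have hz21 := h 2 0
  have hz20 := h 2 1
  have hz12 := h 0 2
  have hz02 := h 1 2
  simp only [Equiv.swap_apply_left, Equiv.swap_apply_right,
    Equiv.swap_apply_of_ne_of_ne (show (2 : Fin 3) ≠ 0 by decide) (show (2 : Fin 3) ≠ 1 by decide)]
    at hz10 hz01 hz21 hz20 hz12 hz02
  rw [← hz, mem_I1set_iff, ← hz10, ← hz01, ← hz21, ← hz20, ← hz12, ← hz02]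
  constructor
  · rintro ⟨h1, h2, h3⟩
    exact ⟨h3 1 0 (by decide), h1 _ _, h3 2 1 (by decide), h3 2 0 (by decide), h1 _ _, h1 _ _⟩
  · rintro ⟨k1, k2, k3, k4, k5, k6⟩
    have hn : ∀ i, ‖y i i‖ ≤ 1 := fun i => (norm_diag_of_mem_I1set hy i).le
    refine ⟨fun i j => ?_, fun i => ?_, fun i j hij => ?_⟩
    · fin_cases i <;> fin_cases j
      · exact hz00 ▸ hn 1
      · exact k2
      · exact k6
      · exact k1.le
      · exact hz11 ▸ hn 0
      · exact k5
      · exact k4.le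
      · exact k3.le
      · exact hz22 ▸ hn 2
    · fin_cases i
      · exact hz00 ▸ hyd 1
      · exact hz11 ▸ hyd 0
      · exact hz22 ▸ hyd 2
    · fin_cases i <;> fin_cases j <;> first | exact absurd hij (by decide) | assumption

theorem isRepSet_swap :
    IsRepSet p 3 (permGL p 3 (Equiv.swap (0 : Fin 3) 1)) (elemReps 0 1 (by decide) 1) := by
  refine isRepSet_elemReps _ one_ne_zero (fun t => ?_) (fun x hx => ?_) fun y hy => ?_
  · exact elemGL_mem_I1set _ (by rw [mul_one]; exact PadicInt.norm_le_one _)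
      fun h => absurd h (by decide)
  · rw [div_one]
    exact ((mem_I1set_iff x).1 hx).1 0 1
  · have h := conj_swap_mem_I1set_iff (fun _ => 0) y hy
    rw [powGL_zero, mul_one] at h
    obtain ⟨h0, -, h2⟩ := (mem_I1set_iff y).1 hy
    simp only [sub_self, zpow_zero, one_mul] at h
    rw [permGL_eq, h, div_one]
    exact ⟨fun h => h.1, fun h => ⟨h, h0 _ _, h2 _ _ (by decide), h2 _ _ (by decide), h0 _ _, h0 _ _⟩⟩

theorem wS_swap_eq (a b : ℤ) : wS p 3 (Equiv.swap (0 : Fin 3) 1) ![a, b] =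
    weylGL ℚ_[p] (Equiv.swap 0 1) * powGL ![a, b, 0] := by
  rw [wS, permGL_eq, tGL_eq]
  congr 2
  funext i
  fin_cases i <;> rfl

theorem inv_p_mul_norm_lt_one {x : ℚ_[p]} (hx : ‖x‖ ≤ 1) : (p : ℝ)⁻¹ * ‖x‖ < 1 := by
  rw [← Padic.norm_p]
  exact mul_lt_one_of_nonneg_of_lt_one_left (norm_nonneg _) Padic.norm_p_lt_one hx

theorem p_mul_norm_le_one_iff (x : ℚ_[p]) : (p : ℝ) * ‖x‖ ≤ 1 ↔ ‖x‖ < 1 := by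
  rw [← norm_div_p_le_one_iff, norm_div, Padic.norm_p, div_inv_eq_mul, mul_comm]

theorem isRepSet_swap_zero_neg_one :
    IsRepSet p 3 (wS p 3 (Equiv.swap (0 : Fin 3) 1) ![0, -1]) (elemReps 1 2 (by decide) 1) := by
  refine isRepSet_elemReps _ one_ne_zero (fun t => ?_) (fun x hx => ?_) fun y hy => ?_
  · exact elemGL_mem_I1set _ (by rw [mul_one]; exact PadicInt.norm_le_one _)
      fun h => absurd h (by decide)
  · rw [div_one]
    exact ((mem_I1set_iff x).1 hx).1 1 2
  · have h := conj_swap_mem_I1set_iff ![0, -1, 0] y hy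
    obtain ⟨h0, -, h2⟩ := (mem_I1set_iff y).1 hy
    rw [wS_swap_eq, h, div_one, ← p_mul_norm_le_one_iff (y 1 2)]
    simp only [norm_mul, norm_zpow, Padic.norm_p, Matrix.cons_val]
    simp only [sub_zero, zero_sub, neg_neg, sub_self, zpow_zero, zpow_one, _root_.zpow_neg_one,
      inv_inv, one_mul]
    exact ⟨fun h => h.2.2.2.2.2, fun h => ⟨inv_p_mul_norm_lt_one (h0 _ _),
      (p_mul_norm_le_one_iff _).2 (h2 _ _ (by decide)), h2 _ _ (by decide),
      inv_p_mul_norm_lt_one (h0 _ _), h0 _ _, h⟩⟩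

theorem isRepSet_swap_one_zero :
    IsRepSet p 3 (wS p 3 (Equiv.swap (0 : Fin 3) 1) ![1, 0]) (elemReps 2 0 (by decide) p) := by
  refine isRepSet_elemReps _ p_ne_zero (fun t => ?_) (fun x hx => ?_) fun y hy => ?_
  · have hlt : ‖((liftZ t : ℤ_[p]) : ℚ_[p]) * p‖ < 1 := by
      rw [mul_comm, norm_mul, Padic.norm_p]
      exact inv_p_mul_norm_lt_one (PadicInt.norm_le_one _)
    exact elemGL_mem_I1set _ hlt.le fun _ => hlt
  · rw [norm_div_p_le_one_iff]
    exact ((mem_I1set_iff x).1 hx).2.2 2 0 (by decide)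
  · have h := conj_swap_mem_I1set_iff ![1, 0, 0] y hy
    obtain ⟨h0, -, h2⟩ := (mem_I1set_iff y).1 hy
    rw [wS_swap_eq, h, norm_div, Padic.norm_p, div_inv_eq_mul, mul_comm ‖y 2 0‖]
    simp only [norm_mul, norm_zpow, Padic.norm_p, Matrix.cons_val]
    simp only [sub_zero, zero_sub, sub_self, zpow_zero, zpow_one, _root_.zpow_neg_one,
      inv_inv, one_mul]
    exact ⟨fun h => h.2.2.1, fun h => ⟨inv_p_mul_norm_lt_one (h0 _ _),
      (p_mul_norm_le_one_iff _).2 (h2 _ _ (by decide)), h, h2 _ _ (by decide),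
      (inv_p_mul_norm_lt_one (h0 _ _)).le, h0 _ _⟩⟩

end RepSets

section Standard

variable {p}

theorem norm_iotaM_apply_le_one (m : MM p 3) (i j : Fin 3) : ‖iotaM p 3 m i j‖ ≤ 1 :=
  (m i j).norm_le_one

theorem norm_p_zpow (k : ℤ) : ‖(p : ℚ_[p]) ^ k‖ = (p : ℝ) ^ (-k) := by
  rw [norm_zpow, Padic.norm_p, _root_.inv_zpow']

theorem nonneg_of_norm_p_zpow_le_one {k : ℤ} (h : ‖(p : ℚ_[p]) ^ k‖ ≤ 1) : 0 ≤ k := by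
  by_contra hk
  rw [norm_p_zpow] at h
  exact absurd h (one_lt_zpow₀ (Nat.one_lt_cast.2 (Fact.out : p.Prime).one_lt) (by omega)).not_ge

theorem norm_p_zpow_le_one {k : ℤ} (hk : 0 ≤ k) : ‖(p : ℚ_[p]) ^ k‖ ≤ 1 := by
  rw [norm_p_zpow]
  exact zpow_le_one_of_nonpos₀ (Nat.one_le_cast.2 (Fact.out : p.Prime).one_le) (by omega)

theorem norm_p_zpow_lt_one {k : ℤ} (hk : 0 < k) : ‖(p : ℚ_[p]) ^ k‖ < 1 := by
  rw [norm_p_zpow]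
  exact zpow_lt_one_of_neg₀ (Nat.one_lt_cast.2 (Fact.out : p.Prime).one_lt) (by omega)

theorem eq_add_of_powGL_eq {n e : Fin 3 → ℤ} {k : ℤ} {m : MM p 3} {u : GG p 3}
    (hu : u ∈ I1set p 3) (h : powGL n = piSc p 3 k * iotaM p 3 m * powGL e * u) (i : Fin 3) :
    n i = k + e i := by
  have h1 : iotaM p 3 m = powGL (n - fun _ => k) * (u⁻¹ * powGL (-e)) := by
    rw [sub_eq_neg_add, powGL_add, ← powGL_inv, ← powGL_inv, ← piSc_eq, h]
    group
  have h2 : iotaM p 3 m⁻¹ = powGL e * (u * powGL ((fun _ => k) - n)) := by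
    rw [sub_eq_add_neg, add_comm, powGL_add, ← powGL_inv, ← piSc_eq, h, map_inv]
    group
  have k1 := norm_iotaM_apply_le_one m i i
  have k2 := norm_iotaM_apply_le_one m⁻¹ i i
  rw [h1, powGL_mul_apply, mul_powGL_apply, mul_left_comm, ← zpow_add₀ p_ne_zero, norm_mul,
    norm_diag_of_mem_I1set (inv_mem_I1set hu), one_mul] at k1
  rw [h2, powGL_mul_apply, mul_powGL_apply, mul_left_comm, ← zpow_add₀ p_ne_zero, norm_mul,
    norm_diag_of_mem_I1set hu, one_mul] at k2
  have l1 := nonneg_of_norm_p_zpow_le_one k1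
  have l2 := nonneg_of_norm_p_zpow_le_one k2
  simp only [Pi.sub_apply, Pi.neg_apply] at l1 l2
  omega

theorem not_mem_Sset {σ : Equiv.Perm (Fin 3)} {a : Fin 2 → ℤ} (ha : a ∈ Sset p 3 σ) {i j : Fin 3}
    (h : i ≠ j) (hσ : σ j < σ i) :
    ¬(expo 3 a i ≤ expo 3 a j ∧ (j < i → expo 3 a i < expo 3 a j)) := by
  rintro ⟨h1, h2⟩
  have hI : elemGL i j h ((p : ℚ_[p]) ^ (expo 3 a j - expo 3 a i)) ∈ Iset p 3 := by
    obtain ⟨m, hm, hm'⟩ := elemGL_mem_I1set h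
      (norm_p_zpow_le_one (p := p) (k := expo 3 a j - expo 3 a i) (by omega))
      fun hji => norm_p_zpow_lt_one (by have := h2 hji; omega)
    exact ⟨m, hm.1, hm'⟩
  have hconj : wS p 3 σ a * elemGL i j h ((p : ℚ_[p]) ^ (expo 3 a j - expo 3 a i)) *
      (wS p 3 σ a)⁻¹ = elemGL (σ i) (σ j) (σ.injective.ne h) 1 := by
    rw [mul_inv_eq_iff_eq_mul, wS, permGL_eq, tGL_eq, mul_assoc, powGL_mul_elemGL,
      ← zpow_add₀ p_ne_zero, ← mul_assoc, weylGL_mul_elemGL, mul_assoc]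
    simp
  have hK := ha _ hI
  rw [hconj] at hK
  obtain ⟨m, hm, hm'⟩ := hK ⟨elemGL (σ i) (σ j) (σ.injective.ne h) 1, by
    rw [iotaM_elemGL, PadicInt.coe_one]⟩
  have h3 := (toZMod_eq_zero_iff _).1 (hm (σ i) (σ j) hσ)
  have h4 := congrArg (fun g : GG p 3 => g (σ i) (σ j)) hm'
  simp only [elemGL_apply, if_neg (σ.injective.ne h), and_self, if_true, zero_add] at h4
  rw [PadicInt.norm_def, show ((m (σ i) (σ j) : ℤ_[p]) : ℚ_[p]) = 1 from h4, norm_one] at h3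
  exact lt_irrefl _ h3

variable {V : Type} [AddCommGroup V] [Module (kb p) V]
variable {ρ : Representation (kb p) (Gk p 3) V} {v₀ : V}

theorem expo_three (a : Fin 2 → ℤ) : expo 3 a 0 = a 0 ∧ expo 3 a 1 = a 1 ∧ expo 3 a 2 = 0 :=
  ⟨rfl, rfl, rfl⟩

theorem IsStd.isEqv {σ : Equiv.Perm (Fin 3)} {a : Fin 2 → ℤ} {f : GG p 3 → V}
    (hf : IsStd p 3 ρ v₀ σ a f) : IsEqv ρ f := ⟨hf.1.1, hf.2.1⟩

theorem IsStd.apply_powGL {σ : Equiv.Perm (Fin 3)} {a : Fin 2 → ℤ} {f : GG p 3 → V}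
    (hf : IsStd p 3 ρ v₀ σ a f) (n : Fin 3 → ℤ) :
    f (powGL n) = if n 0 - n 2 = a 0 ∧ n 1 - n 2 = a 1 then
      ρ (weylGL (ZMod p) σ⁻¹) v₀ else 0 := by
  obtain ⟨e0, e1, e2⟩ := expo_three a
  split_ifs with h
  · have hn : n = (fun _ => n 2) + expo 3 a := by
      funext i
      fin_cases i
      · show n 0 = n 2 + expo 3 a 0
        omega
      · show n 1 = n 2 + expo 3 a 1
        omega
      · show n 2 = n 2 + expo 3 a 2
        omega
    have hv := hf.2.2.2
    have hw : wS p 3 σ a = iotaM p 3 (weylGL _ σ) * powGL (expo 3 a) := by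
      rw [iotaM_weylGL]; rfl
    rw [hw, hf.isEqv.apply_iotaM_mul, redM_weylGL] at hv
    rw [hn, powGL_add, hf.isEqv.apply_powGL_const_mul, ← hv, ← rho_mul, ← weylGL_mul,
      inv_mul_cancel, weylGL_one, map_one, Module.End.one_apply]
  · by_contra hne
    obtain ⟨k, m, u, hu, heq⟩ := hf.2.2.1 _ hne
    have := eq_add_of_powGL_eq hu heq
    have h0 := this 0
    have h1 := this 1
    have h2 := this 2
    exact h ⟨by omega, by omega⟩

theorem IsFsr.spec {a : Fin 2 → ℤ} {f : GG p 3 → V} (hf : IsFsr p ρ v₀ a f) :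
    IsEqv ρ f ∧ a 0 ≤ 0 ∧ a 1 ≤ 0 ∧ ∀ n, f (powGL n) =
      if n 0 - n 2 = a 0 ∧ n 1 - n 2 = a 1 then
        (if a 1 < a 0 then ρ (weylGL (ZMod p) (Equiv.swap 0 1)) v₀ else v₀) else 0 := by
  obtain ⟨e0, e1, e2⟩ := expo_three a
  rcases hf with ⟨ha, hf⟩ | ⟨ha, hf⟩
  · have h1 := not_mem_Sset ha (i := 1) (j := 0) (by decide) (by decide)
    have h2 := not_mem_Sset ha (i := 2) (j := 1) (by decide) (by decide)
    have h3 : (0 : Fin 3) < 1 := by decide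
    have h4 : (1 : Fin 3) < 2 := by decide
    simp only [h3, h4, true_imp_iff, e0, e1, e2] at h1 h2
    refine ⟨hf.isEqv, by omega, by omega, fun n => ?_⟩
    rw [hf.apply_powGL, if_neg (show ¬ a 1 < a 0 by omega), inv_one, weylGL_one, map_one,
      Module.End.one_apply]
  · have h1 := not_mem_Sset ha (i := 0) (j := 1) (by decide) (by decide)
    have h2 := not_mem_Sset ha (i := 2) (j := 1) (by decide) (by decide)
    have h3 := not_mem_Sset ha (i := 2) (j := 0) (by decide) (by decide)
    have h4 : ¬(1 : Fin 3) < 0 := by decide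
    have h5 : (1 : Fin 3) < 2 := by decide
    have h6 : (0 : Fin 3) < 2 := by decide
    simp only [h4, h5, h6, true_imp_iff, false_imp_iff, and_true, e0, e1, e2] at h1 h2 h3
    refine ⟨hf.isEqv, by omega, by omega, fun n => ?_⟩
    rw [hf.apply_powGL, if_pos (show a 1 < a 0 by omega), Equiv.swap_inv]

variable {η : (ZMod p)ˣ →* (kb p)ˣ}

theorem unitOf_coe (u : (ZMod p)ˣ) : unitOf p (u : ZMod p) = u := by
  rw [unitOf, dif_neg u.ne_zero]
  exact Units.ext rfl

theorem exists_lift_torusGL (d : Fin 3 → (ZMod p)ˣ) :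
    torusGL (fun k => liftU (d k)) ∈ Ipre p 3 ∧
      redM p 3 (torusGL fun k => liftU (d k)) = torusGL d := by
  have h : redM p 3 (torusGL fun k => liftU (d k)) = torusGL d := by
    rw [redM_torusGL]
    simp only [redUnit_liftU]
  refine ⟨fun i j hij => ?_, h⟩
  rw [h, torusGL_apply, if_neg hij.ne']

theorem mem_eigU_two (hfix : ∀ m ∈ I1pre p 3, ρ (redM p 3 m) v₀ = v₀)
    (hχ : ∀ m ∈ Ipre p 3, ρ (redM p 3 m) v₀ =
      (η (unitOf p ((redM p 3 m : Matrix (Fin 3) (Fin 3) (ZMod p)) 2 2)) : kb p) • v₀) :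
    v₀ ∈ eigU ρ η 2 := by
  refine ⟨fun i j h t => ?_, fun d => ?_⟩
  · have hr : redM p 3 (elemGL i j h.ne (liftZ t)) = elemGL i j h.ne t := by
      rw [redM_elemGL, toZMod_liftZ]
    rw [← hr]
    refine hfix _ ⟨fun a b hab => ?_, fun a => ?_⟩
    · rw [hr, elemGL_apply, if_neg hab.ne', if_neg, add_zero]
      rintro ⟨rfl, rfl⟩
      exact lt_asymm h hab
    · rw [hr, elemGL_apply, if_pos rfl, if_neg, add_zero]
      rintro ⟨rfl, h2⟩
      exact h.ne h2.symm
  · obtain ⟨h1, h2⟩ := exists_lift_torusGL d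
    have := hχ _ h1
    rwa [h2, torusGL_apply, if_pos rfl, unitOf_coe] at this

end Standard

section Operators

variable {p}
variable {V : Type} [AddCommGroup V] [Module (kb p) V]
variable {ρ : Representation (kb p) (Gk p 3) V} {η : (ZMod p)ˣ →* (kb p)ˣ} {f : GG p 3 → V}

theorem sum_rho_rootTorus_smul (hη : η ≠ 1) {i j : Fin 3} (hij : i ≠ j) {l : Fin 3} {y : V}
    (hy : ∀ d, ρ (torusGL d) y = (η (d l) : kb p) • y) :
    ∑ u : (ZMod p)ˣ, ρ (torusGL (rootTorus i j u)) y =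
      (if l = i ∨ l = j then 0 else -1 : kb p) • y := by
  simp only [hy, ← Finset.sum_smul]
  rw [sum_rootTorus hη hij]

theorem IsEqv.apply_powGL_mul_elemGL_mul_of_lt (hf : IsEqv ρ f) {n : Fin 3 → ℤ} {i j : Fin 3}
    (h : i ≠ j) (hn : n i < n j) (u : (ZMod p)ˣ) (g : GG p 3) :
    f (powGL n * (elemGL i j h ((liftZ (u : ZMod p) : ℤ_[p]) : ℚ_[p]) * g)) =
      ρ (torusGL (rootTorus i j u)) (ρ (weylGL (ZMod p) (Equiv.swap i j))
        (f (powGL (n ∘ Equiv.swap i j) *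
          (elemGL j i h.symm ((↑(liftU u)⁻¹ : ℤ_[p]) : ℚ_[p]) * g)))) := by
  obtain ⟨z, hz⟩ : ∃ z : ℤ_[p], (z : ℚ_[p]) = (p : ℚ_[p]) ^ (n j - n i) :=
    ⟨⟨_, norm_p_zpow_le_one (by omega)⟩, rfl⟩
  have hz0 : PadicInt.toZMod z = 0 := by
    rw [toZMod_eq_zero_iff, PadicInt.norm_def, hz]
    exact norm_p_zpow_lt_one (by omega)
  have e : elemGL i j h ((liftZ (u : ZMod p) : ℤ_[p]) : ℚ_[p]) =
      elemGL j i h.symm ((↑(liftU u)⁻¹ : ℤ_[p]) : ℚ_[p]) *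
        torusGL (fun k => coeUnit (rootTorus i j (liftU u) k)) *
        weylGL ℚ_[p] (Equiv.swap i j) *
        elemGL j i h.symm ((↑(liftU u)⁻¹ : ℤ_[p]) : ℚ_[p]) := by
    rw [← iotaM_elemGL, ← iotaM_elemGL, ← iotaM_torusGL, ← iotaM_weylGL, ← coe_liftU,
      elemGL_eq_mul_weylGL_swap, map_mul, map_mul, map_mul]
  have hr : (fun k => redUnit (rootTorus i j (liftU u) k)) = rootTorus i j u := by
    funext k
    rw [map_rootTorus, redUnit_liftU]
  rw [e]
  simp only [mul_assoc]
  rw [hf.apply_powGL_mul_elemGL_mul n j i h.symm (z := z * ↑(liftU u)⁻¹)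
      (by rw [PadicInt.coe_mul, hz]), map_mul, hz0, zero_mul, elemGL_zero, map_one,
    Module.End.one_apply, hf.apply_powGL_mul_torusGL_mul, hr, hf.apply_powGL_mul_weylGL_mul]

/-- The torus acts on the values of `f` at the diagonal matrices `p ^ n` through `η` of the last
coordinate. -/
def HasTorusChar (ρ : Representation (kb p) (Gk p 3) V) (η : (ZMod p)ˣ →* (kb p)ˣ)
    (f : GG p 3 → V) : Prop :=
  ∀ (n : Fin 3 → ℤ) d, ρ (torusGL d) (f (powGL n)) = (η (d 2) : kb p) • f (powGL n)

theorem IsEqv.apply_powGL_eq_zero (hirr : IsIrred p 3 ρ) (hη : η ≠ 1) {v : V}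
    (hv : v ∈ eigU ρ η 2) (hne : v ≠ 0) (hf : IsEqv ρ f) (ht : HasTorusChar ρ η f)
    {n : Fin 3 → ℤ} (hn : ∃ i, n 2 < n i) : f (powGL n) = 0 := by
  obtain ⟨hmono, hst⟩ := (Tuple.eq_sort_iff (σ := Tuple.sort n) (f := n)).1 rfl
  refine eq_zero_of_fixed_conj hirr hη hv hne (Tuple.sort n) (fun h2 => ?_) (fun i j h t => ?_)
    (ht n)
  · obtain ⟨i, hi⟩ := hn
    have := hmono (show (Tuple.sort n).symm i ≤ 2 from Fin.le_last _)
    simp only [Function.comp_apply, h2, Equiv.apply_symm_apply] at this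
    omega
  · refine hf.fixed_powGL n _ ?_ t
    rcases (hmono h.le).lt_or_eq with h1 | h1
    · exact Or.inl h1
    · exact Or.inr ⟨h1, hst i j h h1⟩

theorem IsEqv.sum_elemGL_two_one_eq_zero (hirr : IsIrred p 3 ρ) (hη : η ≠ 1) {v : V}
    (hv : v ∈ eigU ρ η 2) (hne : v ≠ 0) (hf : IsEqv ρ f) (ht : HasTorusChar ρ η f)
    (n : Fin 3 → ℤ) :
    ∑ t : ZMod p, f (powGL n * elemGL 2 1 (by decide) ((liftZ t : ℤ_[p]) : ℚ_[p])) = 0 := by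
  rcases lt_trichotomy (n 1) (n 2) with h12 | h12 | h12
  · obtain ⟨z, hz⟩ : ∃ z : ℤ_[p], (z : ℚ_[p]) = (p : ℚ_[p]) ^ (n 2 - n 1) :=
      ⟨⟨_, norm_p_zpow_le_one (by omega)⟩, rfl⟩
    have hz0 : PadicInt.toZMod z = 0 := by
      rw [toZMod_eq_zero_iff, PadicInt.norm_def, hz]
      exact norm_p_zpow_lt_one (by omega)
    have h (t : ZMod p) :
        f (powGL n * elemGL 2 1 (by decide) ((liftZ t : ℤ_[p]) : ℚ_[p])) = f (powGL n) := by
      have := hf.apply_powGL_mul_elemGL_mul n 2 1 (by decide) (s := ((liftZ t : ℤ_[p]) : ℚ_[p]))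
        (z := z * liftZ t) (by rw [PadicInt.coe_mul, hz]) 1
      rwa [map_mul, hz0, zero_mul, elemGL_zero, map_one, Module.End.one_apply, mul_one,
        mul_one] at this
    simp only [h]
    exact sum_const_zmod _
  · have h (t : ZMod p) :
        f (powGL n * elemGL 2 1 (by decide) ((liftZ t : ℤ_[p]) : ℚ_[p])) =
        ρ (weylGL (ZMod p) (Equiv.swap 1 2)) (ρ (elemGL 1 2 (by decide) t)
          (ρ (weylGL (ZMod p) (Equiv.swap 1 2)) (f (powGL n)))) := by
      have := hf.apply_powGL_mul_elemGL_mul n 2 1 (by decide) (s := ((liftZ t : ℤ_[p]) : ℚ_[p]))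
        (z := liftZ t) (by rw [h12, sub_self, zpow_zero, one_mul]) 1
      have hw := weylGL_mul_elemGL (Equiv.swap 1 2) 1 2 (by decide) t
      simp only [Equiv.swap_apply_left, Equiv.swap_apply_right] at hw
      rw [mul_one, mul_one, toZMod_liftZ] at this
      rw [this, ← rho_mul _ (elemGL 1 2 _ t), ← rho_mul, ← mul_assoc, hw, mul_assoc,
        weylGL_swap_mul_self, mul_one]
    simp only [h]
    rw [← map_sum, ← heckeT_apply]
    by_cases h02 : n 0 ≤ n 2
    · have hm : f (powGL n) ∈ eigU ρ η 2 := by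
        refine ⟨fun i j h t => hf.fixed_powGL n h.ne ?_ t, ht n⟩
        fin_cases i <;> fin_cases j <;> simp at h ⊢ <;> omega
      obtain ⟨c, -, hc⟩ := heckeT_zero_one_eq_smul hirr hη hm
      rw [heckeT_one_two_eq_zero hirr hη hm hc, map_zero]
    · rw [hf.apply_powGL_eq_zero hirr hη hv hne ht ⟨0, not_le.1 h02⟩, map_zero, map_zero]
  · rw [sum_eq_zero_add_sum_units, liftZ_zero, PadicInt.coe_zero, elemGL_zero, mul_one,
      hf.apply_powGL_eq_zero hirr hη hv hne ht ⟨1, h12⟩, zero_add]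
    have h (u : (ZMod p)ˣ) :
        f (powGL n * elemGL 2 1 (by decide) ((liftZ (u : ZMod p) : ℤ_[p]) : ℚ_[p])) =
        ρ (torusGL (rootTorus 2 1 u)) (ρ (weylGL (ZMod p) (Equiv.swap 2 1))
          (f (powGL (n ∘ Equiv.swap 2 1)))) := by
      have := hf.apply_powGL_mul_elemGL_mul_of_lt (show (2 : Fin 3) ≠ 1 by decide) h12 u 1
      have hI : elemGL 1 2 (by decide) ((↑(liftU u)⁻¹ : ℤ_[p]) : ℚ_[p]) ∈ I1set p 3 :=
        elemGL_mem_I1set _ (PadicInt.norm_le_one _) fun h => absurd h (by decide)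
      rw [mul_one, mul_one, hf.2 _ hI] at this
      exact this
    simp only [h]
    rw [sum_rho_rootTorus_smul hη (by decide) (l := 1), if_pos (Or.inr rfl), zero_smul]
    intro d
    rw [← rho_mul, torusGL_mul_weylGL, rho_mul, ht, map_smul]
    simp

theorem hasTorusChar_of_Ipre (hf : IsEqv ρ f)
    (h : ∀ m ∈ Ipre p 3, ∀ x : GG p 3, f (x * iotaM p 3 m) =
      (η (unitOf p ((redM p 3 m : Matrix (Fin 3) (Fin 3) (ZMod p)) 2 2)) : kb p) • f x) :
    HasTorusChar ρ η f := by
  intro n d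
  obtain ⟨h1, h2⟩ := exists_lift_torusGL d
  have h3 := h _ h1 (powGL n)
  have h4 := hf.apply_powGL_mul_torusGL_mul n (fun k => liftU (d k)) 1
  rw [h2, torusGL_apply, if_pos rfl, unitOf_coe, iotaM_torusGL] at h3
  rw [mul_one, mul_one, h3] at h4
  simp only [redUnit_liftU] at h4
  exact h4.symm

theorem isEqv_of_Ipre (hf : IndMem p 3 ρ f)
    (h : ∀ m ∈ Ipre p 3, ∀ x : GG p 3, f (x * iotaM p 3 m) =
      (η (unitOf p ((redM p 3 m : Matrix (Fin 3) (Fin 3) (ZMod p)) 2 2)) : kb p) • f x) :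
    IsEqv ρ f := by
  refine ⟨hf.1, ?_⟩
  rintro _ ⟨m, hm, rfl⟩ x
  have h1 : unitOf p 1 = 1 := by rw [← Units.val_one, unitOf_coe]
  rw [h m hm.1, hm.2 2, h1, map_one, Units.val_one, one_smul]

theorem hk_swap_one_zero_eq_zero (hirr : IsIrred p 3 ρ) (hη : η ≠ 1) {v : V}
    (hv : v ∈ eigU ρ η 2) (hne : v ≠ 0) (hf : IsEqv ρ f) (ht : HasTorusChar ρ η f)
    {R : Finset (GG p 3)} (hR : IsRepSet p 3 (wS p 3 (Equiv.swap (0 : Fin 3) 1) ![1, 0]) R) :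
    hk p 3 (wS p 3 (Equiv.swap (0 : Fin 3) 1) ![1, 0]) R f = 0 := by
  refine (hf.hk hR).eq_of_powGL (f' := 0) ⟨fun _ _ _ => (map_zero _).symm, fun _ _ _ => rfl⟩
    fun n => ?_
  rw [hk_apply_eq_sum hf.2 hR _ p_ne_zero isRepSet_swap_one_zero]
  have h (t : ZMod p) : f (powGL n * (elemGL 2 0 (by decide) (((liftZ t : ℤ_[p]) : ℚ_[p]) * p) *
        (wS p 3 (Equiv.swap (0 : Fin 3) 1) ![1, 0])⁻¹)) =
      ρ (weylGL (ZMod p) (Equiv.swap 0 1)) (f (powGL ((n + -![1, 0, 0]) ∘ Equiv.swap 0 1) *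
        elemGL 2 1 (by decide) ((liftZ t : ℤ_[p]) : ℚ_[p]))) := by
    have hw := weylGL_mul_elemGL (Equiv.swap 0 1) 2 1 (by decide) ((liftZ t : ℤ_[p]) : ℚ_[p])
    simp only [Equiv.swap_apply_right, Equiv.swap_apply_of_ne_of_ne
      (show (2 : Fin 3) ≠ 0 by decide) (show (2 : Fin 3) ≠ 1 by decide)] at hw
    have hp : (p : ℚ_[p]) ^ ((-![1, 0, 0] : Fin 3 → ℤ) 0 - (-![1, 0, 0] : Fin 3 → ℤ) 2) *
        (((liftZ t : ℤ_[p]) : ℚ_[p]) * p) = ((liftZ t : ℤ_[p]) : ℚ_[p]) := by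
      have := p_ne_zero (p := p)
      simp [field]
    rw [wS_swap_eq, _root_.mul_inv_rev, powGL_inv, ← mul_assoc (elemGL _ _ _ _),
      elemGL_mul_powGL, hp, inv_eq_of_mul_eq_one_right (weylGL_swap_mul_self 0 1), mul_assoc,
      ← hw, ← mul_assoc, ← powGL_add, hf.apply_powGL_mul_weylGL_mul]
  simp only [h]
  rw [← map_sum, hf.sum_elemGL_two_one_eq_zero hirr hη hv hne ht, map_zero, Pi.zero_apply]

end Operators

section Standard

variable {p}
variable {V : Type} [AddCommGroup V] [Module (kb p) V]
variable {ρ : Representation (kb p) (Gk p 3) V} {η : (ZMod p)ˣ →* (kb p)ˣ} {f : GG p 3 → V}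
variable {R : Finset (GG p 3)}

theorem hk_swap_apply (hf : IsEqv ρ f)
    (hR : IsRepSet p 3 (permGL p 3 (Equiv.swap (0 : Fin 3) 1)) R) (n : Fin 3 → ℤ) :
    hk p 3 (permGL p 3 (Equiv.swap (0 : Fin 3) 1)) R f (powGL n) = ∑ t : ZMod p,
      f (powGL n * (elemGL 0 1 (by decide) ((liftZ t : ℤ_[p]) : ℚ_[p]) *
        weylGL ℚ_[p] (Equiv.swap 0 1))) := by
  rw [hk_apply_eq_sum hf.2 hR _ one_ne_zero isRepSet_swap, permGL_eq,
    inv_eq_of_mul_eq_one_right (weylGL_swap_mul_self 0 1)]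
  simp only [mul_one]

theorem IsEqv.apply_powGL_mul_weylGL (hf : IsEqv ρ f) (n : Fin 3 → ℤ) (σ : Equiv.Perm (Fin 3)) :
    f (powGL n * weylGL ℚ_[p] σ) = ρ (weylGL (ZMod p) σ) (f (powGL (n ∘ σ))) := by
  simpa using hf.apply_powGL_mul_weylGL_mul n σ 1

theorem hk_swap_apply_of_lt (hf : IsEqv ρ f)
    (hR : IsRepSet p 3 (permGL p 3 (Equiv.swap (0 : Fin 3) 1)) R) {n : Fin 3 → ℤ}
    (hn : n 1 < n 0) : hk p 3 (permGL p 3 (Equiv.swap (0 : Fin 3) 1)) R f (powGL n) = 0 := by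
  obtain ⟨z, hz⟩ : ∃ z : ℤ_[p], (z : ℚ_[p]) = (p : ℚ_[p]) ^ (n 0 - n 1) :=
    ⟨⟨_, norm_p_zpow_le_one (by omega)⟩, rfl⟩
  have hz0 : PadicInt.toZMod z = 0 := by
    rw [toZMod_eq_zero_iff, PadicInt.norm_def, hz]
    exact norm_p_zpow_lt_one (by omega)
  rw [hk_swap_apply hf hR, ← sum_const_zmod (p := p) (f (powGL n * weylGL ℚ_[p] (Equiv.swap 0 1)))]
  refine Finset.sum_congr rfl fun t _ => ?_
  rw [hf.apply_powGL_mul_elemGL_mul n 0 1 _ (z := z * liftZ t) (by rw [PadicInt.coe_mul, hz]),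
    map_mul, hz0, zero_mul, elemGL_zero, map_one, Module.End.one_apply]

theorem comp_swap_of_eq {n : Fin 3 → ℤ} (hn : n 0 = n 1) : n ∘ Equiv.swap (0 : Fin 3) 1 = n := by
  funext i
  fin_cases i
  · exact hn.symm
  · exact hn
  · rfl

theorem hk_swap_apply_of_eq (hf : IsEqv ρ f)
    (hR : IsRepSet p 3 (permGL p 3 (Equiv.swap (0 : Fin 3) 1)) R) {n : Fin 3 → ℤ}
    (hn : n 0 = n 1) : hk p 3 (permGL p 3 (Equiv.swap (0 : Fin 3) 1)) R f (powGL n) =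
      heckeT ρ 0 1 (by decide) (f (powGL n)) := by
  rw [hk_swap_apply hf hR, heckeT_apply]
  refine Finset.sum_congr rfl fun t _ => ?_
  rw [hf.apply_powGL_mul_elemGL_mul n 0 1 _ (z := liftZ t)
    (by rw [hn, sub_self, zpow_zero, one_mul]), toZMod_liftZ, hf.apply_powGL_mul_weylGL,
    comp_swap_of_eq hn]

theorem hk_swap_apply_of_gt (hη : η ≠ 1) (hf : IsEqv ρ f)
    (hR : IsRepSet p 3 (permGL p 3 (Equiv.swap (0 : Fin 3) 1)) R) {n : Fin 3 → ℤ}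
    (hn : n 0 < n 1) (ht : ∀ d, ρ (torusGL d) (f (powGL n)) = (η (d 2) : kb p) • f (powGL n)) :
    hk p 3 (permGL p 3 (Equiv.swap (0 : Fin 3) 1)) R f (powGL n) =
      ρ (weylGL (ZMod p) (Equiv.swap 0 1)) (f (powGL (n ∘ Equiv.swap (0 : Fin 3) 1))) -
        f (powGL n) := by
  have h (u : (ZMod p)ˣ) :
      f (powGL n * (elemGL 0 1 (by decide) ((liftZ (u : ZMod p) : ℤ_[p]) : ℚ_[p]) *
        weylGL ℚ_[p] (Equiv.swap 0 1))) =
      ρ (torusGL (rootTorus 0 1 u)) (f (powGL n)) := by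
    have hw := weylGL_mul_elemGL (Equiv.swap 0 1) 0 1 (by decide) ((↑(liftU u)⁻¹ : ℤ_[p]) : ℚ_[p])
    simp only [Equiv.swap_apply_left, Equiv.swap_apply_right] at hw
    have hI : elemGL 0 1 (by decide) ((↑(liftU u)⁻¹ : ℤ_[p]) : ℚ_[p]) ∈ I1set p 3 :=
      elemGL_mem_I1set _ (PadicInt.norm_le_one _) fun h => absurd h (by decide)
    have hs : (n ∘ Equiv.swap (0 : Fin 3) 1) ∘ Equiv.swap (0 : Fin 3) 1 = n := by
      funext i
      simp
    rw [hf.apply_powGL_mul_elemGL_mul_of_lt _ hn, ← hw, ← mul_assoc, hf.2 _ hI,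
      hf.apply_powGL_mul_weylGL, hs, rho_weyl_swap_swap]
  rw [hk_swap_apply hf hR, sum_eq_zero_add_sum_units, liftZ_zero, PadicInt.coe_zero, elemGL_zero,
    one_mul, hf.apply_powGL_mul_weylGL]
  simp only [h]
  rw [sum_rho_rootTorus_smul hη (by decide) ht, if_neg (by decide), neg_one_smul, sub_eq_add_neg]

theorem IsEqv.sum_elemGL_zero_two (hf : IsEqv ρ f) (h0 : ∀ n : Fin 3 → ℤ, n 2 < n 0 → f (powGL n) = 0)
    (n : Fin 3 → ℤ) :
    ∑ t : ZMod p, f (powGL n * elemGL 0 2 (by decide)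
      ((p : ℚ_[p]) ^ (-1 : ℤ) * ((liftZ t : ℤ_[p]) : ℚ_[p]))) = f (powGL n) := by
  rcases lt_or_ge (n 2) (n 0) with hn | hn
  · obtain ⟨z, hz⟩ : ∃ z : ℤ_[p], (z : ℚ_[p]) = (p : ℚ_[p]) ^ (n 0 - n 2 + (-1)) :=
      ⟨⟨_, norm_p_zpow_le_one (by omega)⟩, rfl⟩
    rw [h0 n hn]
    refine Finset.sum_eq_zero fun t _ => ?_
    have := hf.apply_powGL_mul_elemGL_mul n 0 2 (by decide)
      (s := (p : ℚ_[p]) ^ (-1 : ℤ) * ((liftZ t : ℤ_[p]) : ℚ_[p])) (z := z * liftZ t)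
      (by rw [PadicInt.coe_mul, hz, zpow_add₀ p_ne_zero, mul_assoc]) 1
    rwa [mul_one, mul_one, h0 n hn, map_zero] at this
  · rw [sum_eq_zero_add_sum_units, liftZ_zero, PadicInt.coe_zero, mul_zero, elemGL_zero, mul_one,
      add_eq_left]
    refine Finset.sum_eq_zero fun u _ => ?_
    have hI : elemGL 2 0 (by decide) ((p : ℚ_[p]) * ((↑(liftU u)⁻¹ : ℤ_[p]) : ℚ_[p])) ∈
        I1set p 3 := by
      have hlt : ‖(p : ℚ_[p]) * ((↑(liftU u)⁻¹ : ℤ_[p]) : ℚ_[p])‖ < 1 := by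
        rw [norm_mul, Padic.norm_p]
        exact inv_p_mul_norm_lt_one (PadicInt.norm_le_one _)
      exact elemGL_mem_I1set _ hlt.le fun _ => hlt
    have e1 := elemGL_mul_powGL ![1, 0, 0] 0 2 (by decide) ((liftZ (u : ZMod p) : ℤ_[p]) : ℚ_[p])
    have e2 := elemGL_mul_powGL ![1, 0, 0] 2 0 (by decide) ((↑(liftU u)⁻¹ : ℤ_[p]) : ℚ_[p])
    simp only [Matrix.cons_val, zero_sub, sub_zero, zpow_one] at e1 e2
    have hn' : n = (n - ![1, 0, 0]) + ![1, 0, 0] := (sub_add_cancel _ _).symm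
    rw [hn', powGL_add, mul_assoc, ← e1, hf.apply_powGL_mul_elemGL_mul_of_lt _ (by simp; omega),
      e2, ← mul_assoc, hf.2 _ hI, ← powGL_add, h0 _ (by
        simp only [Pi.add_apply, Function.comp_apply, Equiv.swap_apply_left, Equiv.swap_apply_right,
          Pi.sub_apply, Matrix.cons_val]
        omega), map_zero, map_zero]

theorem hk_swap_zero_neg_one_apply (hf : IsEqv ρ f)
    (h0 : ∀ n : Fin 3 → ℤ, n 2 < n 0 → f (powGL n) = 0)
    (hR : IsRepSet p 3 (wS p 3 (Equiv.swap (0 : Fin 3) 1) ![0, -1]) R) (n : Fin 3 → ℤ) :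
    hk p 3 (wS p 3 (Equiv.swap (0 : Fin 3) 1) ![0, -1]) R f (powGL n) =
      ρ (weylGL (ZMod p) (Equiv.swap 0 1)) (f (powGL ((n + ![0, 1, 0]) ∘ Equiv.swap 0 1))) := by
  rw [hk_apply_eq_sum hf.2 hR _ one_ne_zero isRepSet_swap_zero_neg_one]
  have h (t : ZMod p) : f (powGL n * (elemGL 1 2 (by decide) (((liftZ t : ℤ_[p]) : ℚ_[p]) * 1) *
        (wS p 3 (Equiv.swap (0 : Fin 3) 1) ![0, -1])⁻¹)) =
      ρ (weylGL (ZMod p) (Equiv.swap 0 1)) (f (powGL ((n + ![0, 1, 0]) ∘ Equiv.swap 0 1) *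
        elemGL 0 2 (by decide) ((p : ℚ_[p]) ^ (-1 : ℤ) * ((liftZ t : ℤ_[p]) : ℚ_[p])))) := by
    have hw := weylGL_mul_elemGL (Equiv.swap 0 1) 0 2 (by decide)
      ((p : ℚ_[p]) ^ (-1 : ℤ) * ((liftZ t : ℤ_[p]) : ℚ_[p]))
    simp only [Equiv.swap_apply_left, Equiv.swap_apply_of_ne_of_ne
      (show (2 : Fin 3) ≠ 0 by decide) (show (2 : Fin 3) ≠ 1 by decide)] at hw
    have hi : -![(0 : ℤ), -1, 0] = ![0, 1, 0] := by simp
    have e1 := elemGL_mul_powGL ![0, 1, 0] 1 2 (by decide) ((liftZ t : ℤ_[p]) : ℚ_[p])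
    simp only [Matrix.cons_val, zero_sub] at e1
    rw [wS_swap_eq, _root_.mul_inv_rev, powGL_inv, hi, ← mul_assoc (elemGL _ _ _ _), mul_one, e1,
      inv_eq_of_mul_eq_one_right (weylGL_swap_mul_self 0 1), mul_assoc, ← hw, ← mul_assoc,
      ← powGL_add, hf.apply_powGL_mul_weylGL_mul]
  simp only [h]
  rw [← map_sum, hf.sum_elemGL_zero_two h0]

variable {v₀ : V} {a : Fin 2 → ℤ}

theorem IsFsr.hk_swap_of_lt (hη : η ≠ 1) (ha : a 1 < a 0)
    (hf : IsFsr p ρ v₀ a f) {f' : GG p 3 → V} (hf' : IsFsr p ρ v₀ ![a 1, a 0] f')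
    (hR : IsRepSet p 3 (permGL p 3 (Equiv.swap (0 : Fin 3) 1)) R) :
    hk p 3 (permGL p 3 (Equiv.swap (0 : Fin 3) 1)) R f = f' := by
  obtain ⟨he, -, -, hs⟩ := hf.spec
  obtain ⟨he', -, -, hs'⟩ := hf'.spec
  replace hs' : ∀ n, f' (powGL n) = if n 0 - n 2 = a 1 ∧ n 1 - n 2 = a 0 then
      (if a 0 < a 1 then ρ (weylGL (ZMod p) (Equiv.swap 0 1)) v₀ else v₀) else 0 := hs'
  simp only [if_neg (not_lt_of_gt ha)] at hs'
  refine (he.hk hR).eq_of_powGL he' fun n => ?_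
  rw [hs']
  simp only [if_pos ha] at hs
  rcases lt_trichotomy (n 0) (n 1) with hn | hn | hn
  · have h0 : f (powGL n) = 0 := by rw [hs, if_neg (by omega)]
    rw [hk_swap_apply_of_gt hη he hR hn (fun d => by simp [h0]), h0, hs, sub_zero]
    simp only [Function.comp_apply, Equiv.swap_apply_left, Equiv.swap_apply_right,
      Equiv.swap_apply_of_ne_of_ne (show (2 : Fin 3) ≠ 0 by decide)
        (show (2 : Fin 3) ≠ 1 by decide)]
    by_cases h : n 0 - n 2 = a 1 ∧ n 1 - n 2 = a 0
    · rw [if_pos h, if_pos h.symm, rho_weyl_swap_swap]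
    · rw [if_neg h, if_neg (fun h' => h h'.symm), map_zero]
  · rw [hk_swap_apply_of_eq he hR hn, hs, if_neg (by omega), if_neg (by omega), map_zero]
  · rw [hk_swap_apply_of_lt he hR hn, if_neg (by omega)]

theorem IsFsr.hk_swap_of_eq (hη : η ≠ 1) {c : kb p}
    (hc : heckeT ρ 0 1 (by decide) v₀ = c • v₀) (ha : a 0 = a 1)
    (hf : IsFsr p ρ v₀ a f) (hR : IsRepSet p 3 (permGL p 3 (Equiv.swap (0 : Fin 3) 1)) R) :
    hk p 3 (permGL p 3 (Equiv.swap (0 : Fin 3) 1)) R f = fun x => c • f x := by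
  obtain ⟨he, -, -, hs⟩ := hf.spec
  refine (he.hk hR).eq_of_powGL
    ⟨fun n m g => by beta_reduce; rw [he.1, map_smul], fun u hu g => by beta_reduce; rw [he.2 u hu]⟩ fun n => ?_
  simp only [if_neg ha.not_gt] at hs
  rcases lt_trichotomy (n 0) (n 1) with hn | hn | hn
  · have h0 : f (powGL n) = 0 := by rw [hs, if_neg (by omega)]
    rw [hk_swap_apply_of_gt hη he hR hn (fun d => by simp [h0]), h0, hs, if_neg, map_zero,
      sub_zero, smul_zero]
    simp only [Function.comp_apply, Equiv.swap_apply_left, Equiv.swap_apply_right]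
    omega
  · rw [hk_swap_apply_of_eq he hR hn, hs]
    split_ifs
    · exact hc
    · rw [map_zero, smul_zero]
  · rw [hk_swap_apply_of_lt he hR hn, hs, if_neg (by omega), smul_zero]

theorem IsFsr.hk_swap_of_gt (hη : η ≠ 1) (hv : v₀ ∈ eigU ρ η 2) (ha : a 0 < a 1)
    (hf : IsFsr p ρ v₀ a f) (hR : IsRepSet p 3 (permGL p 3 (Equiv.swap (0 : Fin 3) 1)) R) :
    hk p 3 (permGL p 3 (Equiv.swap (0 : Fin 3) 1)) R f = fun x => -f x := by
  obtain ⟨he, -, -, hs⟩ := hf.spec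
  refine (he.hk hR).eq_of_powGL
    ⟨fun n m g => by beta_reduce; rw [he.1, map_neg], fun u hu g => by beta_reduce; rw [he.2 u hu]⟩ fun n => ?_
  simp only [if_neg (not_lt_of_gt ha)] at hs
  rcases lt_trichotomy (n 0) (n 1) with hn | hn | hn
  · have ht : ∀ d, ρ (torusGL d) (f (powGL n)) = (η (d 2) : kb p) • f (powGL n) := by
      intro d
      rw [hs]
      split_ifs
      · exact hv.2 d
      · rw [map_zero, smul_zero]
    rw [hk_swap_apply_of_gt hη he hR hn ht, hs (n ∘ _), if_neg, map_zero, zero_sub]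
    simp only [Function.comp_apply, Equiv.swap_apply_left, Equiv.swap_apply_right]
    omega
  · rw [hk_swap_apply_of_eq he hR hn, hs, if_neg (by omega), map_zero, neg_zero]
  · rw [hk_swap_apply_of_lt he hR hn, hs, if_neg (by omega), neg_zero]

theorem IsFsr.hk_swap_zero_neg_one (hf : IsFsr p ρ v₀ a f) {f' : GG p 3 → V}
    (hf' : IsFsr p ρ v₀ ![a 1, a 0 - 1] f')
    (hR : IsRepSet p 3 (wS p 3 (Equiv.swap (0 : Fin 3) 1) ![0, -1]) R) :
    hk p 3 (wS p 3 (Equiv.swap (0 : Fin 3) 1) ![0, -1]) R f = f' := by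
  obtain ⟨he, ha, -, hs⟩ := hf.spec
  obtain ⟨he', -, -, hs'⟩ := hf'.spec
  replace hs' : ∀ n, f' (powGL n) = if n 0 - n 2 = a 1 ∧ n 1 - n 2 = a 0 - 1 then
      (if a 0 - 1 < a 1 then ρ (weylGL (ZMod p) (Equiv.swap 0 1)) v₀ else v₀) else 0 := hs'
  refine (he.hk hR).eq_of_powGL he' fun n => ?_
  rw [hk_swap_zero_neg_one_apply he (fun n hn => by rw [hs, if_neg (by omega)]) hR, hs', hs]
  simp only [Function.comp_apply, Equiv.swap_apply_left, Equiv.swap_apply_right,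
    Equiv.swap_apply_of_ne_of_ne (show (2 : Fin 3) ≠ 0 by decide)
      (show (2 : Fin 3) ≠ 1 by decide), Pi.add_apply, Matrix.cons_val]
  by_cases h : n 0 - n 2 = a 1 ∧ n 1 - n 2 = a 0 - 1
  · rw [if_pos h, if_pos (by omega)]
    by_cases h10 : a 1 < a 0
    · rw [if_pos h10, if_neg (by omega), rho_weyl_swap_swap]
    · rw [if_neg h10, if_pos (by omega)]
  · rw [if_neg h, if_neg (by omega), map_zero]

end Standard

/-- the semi-regular case for `N = 3`. -/
theorem stmt15 (p : ℕ) [Fact p.Prime]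
    {V : Type} [AddCommGroup V] [Module (kb p) V] [FiniteDimensional (kb p) V]
    (ρ : Representation (kb p) (Gk p 3) V) (hirr : IsIrred p 3 ρ)
    (v₀ : V) (hv₀ : v₀ ≠ 0)
    (hfix : ∀ m ∈ I1pre p 3, ρ (redM p 3 m) v₀ = v₀)
    (η : (ZMod p)ˣ →* (kb p)ˣ) (hη : η ≠ 1)
    (hχ : ∀ m ∈ Ipre p 3, ρ (redM p 3 m) v₀ =
      (η (unitOf p ((redM p 3 m : Matrix (Fin 3) (Fin 3) (ZMod p)) 2 2)) : kb p) • v₀) :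
    (∃ c : kb p, (c = 0 ∨ c = -1) ∧
      ∀ (a : Fin 2 → ℤ) (f : GG p 3 → V), IsFsr p ρ v₀ a f →
        ((a 1 < a 0 → ∀ f' : GG p 3 → V, IsFsr p ρ v₀ ![a 1, a 0] f' →
            ∀ R : Finset (GG p 3), IsRepSet p 3 (permGL p 3 (Equiv.swap (0 : Fin 3) 1)) R →
              hk p 3 (permGL p 3 (Equiv.swap (0 : Fin 3) 1)) R f = f') ∧
         (a 0 = a 1 →
            ∀ R : Finset (GG p 3), IsRepSet p 3 (permGL p 3 (Equiv.swap (0 : Fin 3) 1)) R →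
              hk p 3 (permGL p 3 (Equiv.swap (0 : Fin 3) 1)) R f = fun x => c • f x) ∧
         (a 0 < a 1 →
            ∀ R : Finset (GG p 3), IsRepSet p 3 (permGL p 3 (Equiv.swap (0 : Fin 3) 1)) R →
              hk p 3 (permGL p 3 (Equiv.swap (0 : Fin 3) 1)) R f = fun x => - f x))) ∧
    (∀ (a : Fin 2 → ℤ) (f : GG p 3 → V), IsFsr p ρ v₀ a f →
      ∀ f' : GG p 3 → V, IsFsr p ρ v₀ ![a 1, a 0 - 1] f' →
        ∀ R : Finset (GG p 3), IsRepSet p 3 (wS p 3 (Equiv.swap (0 : Fin 3) 1) ![0, -1]) R →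
          hk p 3 (wS p 3 (Equiv.swap (0 : Fin 3) 1) ![0, -1]) R f = f') ∧
    (∀ f : GG p 3 → V, IndMem p 3 ρ f →
      (∀ m ∈ Ipre p 3, ∀ x : GG p 3, f (x * iotaM p 3 m) =
        (η (unitOf p ((redM p 3 m : Matrix (Fin 3) (Fin 3) (ZMod p)) 2 2)) : kb p) • f x) →
      ∀ R : Finset (GG p 3), IsRepSet p 3 (wS p 3 (Equiv.swap (0 : Fin 3) 1) ![1, 0]) R →
        hk p 3 (wS p 3 (Equiv.swap (0 : Fin 3) 1) ![1, 0]) R f = 0) := by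
  have hv := mem_eigU_two hfix hχ
  obtain ⟨c, hc, hcv⟩ := heckeT_zero_one_eq_smul hirr hη hv
  exact ⟨⟨c, hc, fun a f hf => ⟨fun ha f' hf' R hR => hf.hk_swap_of_lt hη ha hf' hR,
    fun ha R hR => hf.hk_swap_of_eq hη hcv ha hR, fun ha R hR => hf.hk_swap_of_gt hη hv ha hR⟩⟩,
    fun a f hf f' hf' R hR => hf.hk_swap_zero_neg_one hf' hR,
    fun f hf h R hR => hk_swap_one_zero_eq_zero hirr hη hv hv₀ (isEqv_of_Ipre hf h)
      (hasTorusChar_of_Ipre (isEqv_of_Ipre hf h) h) hR⟩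

end IH
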